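/- arXiv:1804.01569 — 2 statements merged into one kernel-verified Lean document; each statement's English description precedes it below -/
import Mathlib

section
/- Let q be a power of a prime p > 2 and let C be a smooth plane curve of degree d over F_q with d ≤ q + 1. If C is reflexive (i.e., C has only finitely many flex points), then there exists an F_q-line L such that L intersects C transversely, i.e., L ∩ C consists of d distinct points over the algebraic closure of F_q. -/
open MvPolynomial

noncomputable section

/-- The projective plane over a field `K`, as the projectivization of `K^3`. -/
abbrev ProjPlane (K : Type*) [Field K] := Projectivization K (Fin 3 → K)

variable {F : Type*} [Field F]

/-- A geometric point (over the algebraic closure) lies on the plane curve defined by `f`. -/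
def OnCurve (f : MvPolynomial (Fin 3) F) (P : ProjPlane (AlgebraicClosure F)) : Prop :=
  aeval P.rep f = 0

/-- A geometric point lies on the `F`-rational line with coefficient vector `a`. -/
def OnLine (a : Fin 3 → F) (P : ProjPlane (AlgebraicClosure F)) : Prop :=
  ∑ i, algebraMap F (AlgebraicClosure F) (a i) * P.rep i = 0

/-- The plane curve defined by `f` is smooth: the gradient of `f` is nonzero at every
geometric point of the curve. -/
def SmoothCurve (f : MvPolynomial (Fin 3) F) : Prop :=
  ∀ P : ProjPlane (AlgebraicClosure F), OnCurve f P → ∃ i, aeval P.rep (pderiv i f) ≠ 0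

/-- The `F`-line with coefficients `a` meets the curve defined by `f` transversely:
the intersection consists of exactly `d` distinct geometric points. -/
def Transverse (f : MvPolynomial (Fin 3) F) (a : Fin 3 → F) (d : ℕ) : Prop :=
  {P : ProjPlane (AlgebraicClosure F) | OnCurve f P ∧ OnLine a P}.ncard = d

/-- The restriction of `f` to the line `t ↦ v + t • w`, as a univariate polynomial. -/
def LinePoly (f : MvPolynomial (Fin 3) F) (v w : Fin 3 → AlgebraicClosure F) :
    Polynomial (AlgebraicClosure F) :=
  aeval (fun i => Polynomial.C (v i) + Polynomial.X * Polynomial.C (w i)) f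

/-- `P` is a flex point of the curve defined by `f`: the tangent line at `P` meets the
curve at `P` with intersection multiplicity at least 3. The tangent line is parametrized
through `P.rep` and a direction `w` lying on the tangent line, independent from `P.rep`. -/
def IsFlex (f : MvPolynomial (Fin 3) F) (P : ProjPlane (AlgebraicClosure F)) : Prop :=
  OnCurve f P ∧ ∃ w : Fin 3 → AlgebraicClosure F,
    (¬ ∃ c : AlgebraicClosure F, w = c • P.rep) ∧
    (∑ i, aeval P.rep (pderiv i f) * w i = 0) ∧
    (Polynomial.X : Polynomial (AlgebraicClosure F)) ^ 3 ∣ LinePoly f P.rep w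

/-- The `F`-line with coefficients `a` is the tangent line to the curve `f` at the
geometric point `P`, i.e. `a` is proportional to the gradient of `f` at `P`. -/
def IsTangentAt (f : MvPolynomial (Fin 3) F) (a : Fin 3 → F)
    (P : ProjPlane (AlgebraicClosure F)) : Prop :=
  OnCurve f P ∧ ∃ c : AlgebraicClosure F, c ≠ 0 ∧
    ∀ i, algebraMap F (AlgebraicClosure F) (a i) = c * aeval P.rep (pderiv i f)

/-- The `q`-power Frobenius map on the projective plane. -/
def FrobPt {K : Type*} [Field K] (q : ℕ) (P : ProjPlane K) : ProjPlane K :=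
  Projectivization.mk K (fun i => P.rep i ^ q) (by
    intro hc
    rcases Nat.eq_zero_or_pos q with h0 | h0
    · have := congrFun hc 0
      simp [h0] at this
    · apply P.rep_nonzero
      funext i
      have := congrFun hc i
      simp only [Pi.zero_apply] at this ⊢
      exact pow_eq_zero_iff h0.ne' |>.mp this)

/-- A geometric point of the projective plane is `F`-rational. -/
def IsRationalPt (P : ProjPlane (AlgebraicClosure F)) : Prop :=
  ∃ v : Fin 3 → F, v ≠ 0 ∧ ∃ c : AlgebraicClosure F, c ≠ 0 ∧
    ∀ i, P.rep i = c * algebraMap F (AlgebraicClosure F) (v i)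

/-- The curve defined by `f` is Frobenius non-classical over `F` (with `q = #F`):
the image of every geometric point of the curve under the `q`-power Frobenius lies on
the tangent line at that point. -/
def FrobeniusNonClassical (f : MvPolynomial (Fin 3) F) (q : ℕ) : Prop :=
  ∀ P : ProjPlane (AlgebraicClosure F), OnCurve f P →
    ∑ i, aeval P.rep (pderiv i f) * P.rep i ^ q = 0

section Homogeneous

variable {K σ : Type*} [Field K]

lemma finrank_homogeneousSubmodule_three (n : ℕ) :
    Module.finrank K (homogeneousSubmodule (Fin 3) K n) = (n + 2).choose 2 := by
  classical
  have hset : {s : Fin 3 →₀ ℕ | s.degree = n} =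
      ((Finset.univ.finsuppAntidiag n : Finset (Fin 3 →₀ ℕ)) : Set (Fin 3 →₀ ℕ)) := by
    ext s
    simp [Finset.mem_finsuppAntidiag, Finsupp.degree_eq_sum]
  have e : Module.finrank K (homogeneousSubmodule (Fin 3) K n) =
      Module.finrank K (restrictSupport K {s : Fin 3 →₀ ℕ | s.degree = n}) := by
    rw [homogeneousSubmodule_eq_finsupp_supported]
    rfl
  rw [e, Module.finrank_eq_nat_card_basis (basisRestrictSupport K _), hset]
  simp only [SetLike.coe_sort_coe, Nat.card_eq_fintype_card, Fintype.card_coe,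
    Finset.card_finsuppAntidiag_nat_eq_choose, Finset.card_univ, Fintype.card_fin]
  rw [show 3 + n - 1 = n + 2 by omega, ← Nat.choose_symm_add]

instance finite_homogeneousSubmodule [Finite σ] (n : ℕ) :
    Module.Finite K (homogeneousSubmodule σ K n) :=
  Module.Finite.iff_fg.mpr (homogeneousSubmodule_fg σ K n)

/-- Homogeneous components of a multiple of a homogeneous polynomial. -/
lemma homogeneousComponent_mul_of_isHomogeneous {d : ℕ} {f : MvPolynomial σ K}
    (hf : f.IsHomogeneous d) (c : MvPolynomial σ K) (m : ℕ) :
    homogeneousComponent (m + d) (c * f) = homogeneousComponent m c * f := by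
  conv_lhs => rw [← sum_homogeneousComponent c, Finset.sum_mul, map_sum]
  have h : ∀ i, homogeneousComponent (m + d) (homogeneousComponent i c * f) =
      if i = m then homogeneousComponent m c * f else 0 := by
    intro i
    rw [homogeneousComponent_of_mem (((homogeneousComponent_isHomogeneous i c).mul hf))]
    grind
  simp_rw [h]
  rw [Finset.sum_ite_eq']
  split_ifs with hm
  · rfl
  · rw [homogeneousComponent_eq_zero m c (by simpa using hm), zero_mul]

/-- The top homogeneous component is multiplicative. -/
lemma homogeneousComponent_totalDegree_mul (a b : MvPolynomial σ K) :
    homogeneousComponent (a.totalDegree + b.totalDegree) (a * b) =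
      homogeneousComponent a.totalDegree a * homogeneousComponent b.totalDegree b := by
  have hab : a * b = ∑ j ∈ Finset.range (b.totalDegree + 1), a * homogeneousComponent j b := by
    rw [← Finset.mul_sum, sum_homogeneousComponent]
  rw [hab, map_sum, Finset.sum_eq_single b.totalDegree]
  · rw [homogeneousComponent_mul_of_isHomogeneous (homogeneousComponent_isHomogeneous _ b)]
  · intro j hj hjb
    have hlt : j < b.totalDegree := by
      have := Finset.mem_range.mp hj
      omega
    rw [show a.totalDegree + b.totalDegree = (a.totalDegree + (b.totalDegree - j)) + j by omega,
      homogeneousComponent_mul_of_isHomogeneous (homogeneousComponent_isHomogeneous j b),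
      homogeneousComponent_eq_zero _ a (by omega), zero_mul]
  · simp

lemma homogeneousComponent_totalDegree_ne_zero {a : MvPolynomial σ K} (ha : a ≠ 0) :
    homogeneousComponent a.totalDegree a ≠ 0 := by
  obtain ⟨s, hs, hsd⟩ := Finset.exists_mem_eq_sup a.support (support_nonempty.mpr ha)
    (fun s => s.sum fun _ e => e)
  intro h
  have := congrArg (coeff s) h
  rw [coeff_homogeneousComponent, if_pos, coeff_zero] at this
  · exact mem_support_iff.mp hs this
  · rw [totalDegree, hsd]
    rfl

/-- The top homogeneous component of a divisor of a homogeneous polynomial is a divisor. -/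
lemma homogeneousComponent_totalDegree_dvd {d : ℕ} {f h : MvPolynomial σ K}
    (hf : f.IsHomogeneous d) (hdvd : h ∣ f) : homogeneousComponent h.totalDegree h ∣ f := by
  obtain ⟨k, rfl⟩ := hdvd
  by_cases h0 : h * k = 0
  · rw [h0]
    exact dvd_zero _
  have key := homogeneousComponent_totalDegree_mul h k
  rw [homogeneousComponent_of_mem hf] at key
  split_ifs at key with hd
  · exact ⟨_, key⟩
  · exact absurd key.symm (mul_ne_zero
      (homogeneousComponent_totalDegree_ne_zero (left_ne_zero_of_mul h0))
      (homogeneousComponent_totalDegree_ne_zero (right_ne_zero_of_mul h0)))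

/-- Homogeneous forms with a common nonunit divisor have a common divisor that is a form of
positive degree. -/
lemma exists_isHomogeneous_dvd_of_not_isRelPrime {d e : ℕ} {f g : MvPolynomial σ K}
    (hf0 : f ≠ 0) (hf : f.IsHomogeneous d) (hg : g.IsHomogeneous e) (h : ¬ IsRelPrime f g) :
    ∃ (m : ℕ) (k : MvPolynomial σ K), 0 < m ∧ k ≠ 0 ∧ k.IsHomogeneous m ∧ k ∣ f ∧ k ∣ g := by
  simp only [IsRelPrime, not_forall] at h
  obtain ⟨k, hkf, hkg, hk⟩ := h
  have hk0 : k ≠ 0 := ne_zero_of_dvd_ne_zero hf0 hkf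
  refine ⟨k.totalDegree, homogeneousComponent k.totalDegree k, ?_,
    homogeneousComponent_totalDegree_ne_zero hk0, homogeneousComponent_isHomogeneous _ _,
    homogeneousComponent_totalDegree_dvd hf hkf, homogeneousComponent_totalDegree_dvd hg hkg⟩
  refine Nat.pos_of_ne_zero fun h0 => hk ?_
  rw [totalDegree_eq_zero_iff_eq_C] at h0
  rw [h0]
  refine (IsUnit.mk0 _ fun hc => hk0 ?_).map C
  rw [h0, hc, C_0]

end Homogeneous

section IntersectionBound

variable {K : Type*} [Field K]

/-- A linear map that annihilates all multiples of two coprime plane forms and is surjective in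
some high degree has target of dimension at most the product of the degrees. -/
lemma finrank_le_mul_of_isRelPrime {V : Type*} [AddCommGroup V] [Module K V]
    [Module.Finite K V] {d e : ℕ} {f g : MvPolynomial (Fin 3) K}
    (hf0 : f ≠ 0) (hf : f.IsHomogeneous d) (hg : g.IsHomogeneous e) (hfg : IsRelPrime f g)
    (Λ : MvPolynomial (Fin 3) K →ₗ[K] V) (hΛf : ∀ a, Λ (a * f) = 0) (hΛg : ∀ b, Λ (b * g) = 0)
    (m : ℕ) (hsurj : ∀ y, ∃ s : MvPolynomial (Fin 3) K, s.IsHomogeneous (m + d + e) ∧ Λ s = y) :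
    Module.finrank K V ≤ d * e := by
  let S := homogeneousSubmodule (Fin 3) K
  let φ : S (m + e) × S (m + d) →ₗ[K] MvPolynomial (Fin 3) K :=
    ((LinearMap.mulRight K f).comp (S (m + e)).subtype).coprod
      ((LinearMap.mulRight K g).comp (S (m + d)).subtype)
  let ψ : S m →ₗ[K] MvPolynomial (Fin 3) K := (LinearMap.mulRight K f).comp (S m).subtype
  have hφ : ∀ x, φ x = x.1 * f + x.2 * g := fun x => by simp [φ]
  -- an element of the kernel is determined by its second coordinate, a multiple of `f`
  let π : LinearMap.ker φ →ₗ[K] MvPolynomial (Fin 3) K :=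
    (S (m + d)).subtype.comp ((LinearMap.snd K _ _).comp (LinearMap.ker φ).subtype)
  have hπ : Function.Injective π := by
    rw [injective_iff_map_eq_zero]
    rintro ⟨⟨⟨a, ha⟩, ⟨b, hb⟩⟩, hab⟩ h
    replace h : b = 0 := h
    have h1 : a * f + b * g = 0 := by rw [← hφ ⟨⟨a, ha⟩, ⟨b, hb⟩⟩]; exact hab
    subst h
    have : a = 0 := by simpa [hf0] using h1
    subst this
    rfl
  have hπψ : LinearMap.range π ≤ LinearMap.range ψ := by
    rintro _ ⟨⟨⟨⟨a, ha⟩, ⟨b, hb⟩⟩, hab⟩, rfl⟩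
    have h1 : a * f + b * g = 0 := by rw [← hφ ⟨⟨a, ha⟩, ⟨b, hb⟩⟩]; exact hab
    have h2 : f ∣ b := hfg.dvd_of_dvd_mul_right ⟨-a, by linear_combination h1⟩
    obtain ⟨c, rfl⟩ := h2
    refine ⟨⟨homogeneousComponent m c, homogeneousComponent_isHomogeneous m c⟩, ?_⟩
    change homogeneousComponent m c * f = f * c
    rw [← homogeneousComponent_mul_of_isHomogeneous hf, mul_comm c f]
    exact (homogeneousComponent_of_mem hb).trans (if_pos rfl)
  have hker : Module.finrank K (LinearMap.ker φ) ≤ (m + 2).choose 2 := by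
    rw [← LinearMap.finrank_range_of_inj hπ, ← finrank_homogeneousSubmodule_three (K := K)]
    exact (Submodule.finrank_mono hπψ).trans (LinearMap.finrank_range_le ψ)
  have hφr := LinearMap.finrank_range_add_finrank_ker φ
  let Λ' := Λ.comp (S (m + d + e)).subtype
  have hΛ' : LinearMap.range Λ' = ⊤ := by
    rw [LinearMap.range_eq_top]
    intro y
    obtain ⟨s, hs, rfl⟩ := hsurj y
    exact ⟨⟨s, hs⟩, rfl⟩
  have hΛr := LinearMap.finrank_range_add_finrank_ker Λ'
  have hle : LinearMap.range φ ≤ (LinearMap.ker Λ').map (S (m + d + e)).subtype := by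
    rintro _ ⟨⟨⟨a, ha⟩, ⟨b, hb⟩⟩, rfl⟩
    rw [hφ]
    refine ⟨⟨a * f + b * g, ?_⟩, ?_, rfl⟩
    · refine IsHomogeneous.add ?_ (IsHomogeneous.mul hb hg)
      convert IsHomogeneous.mul ha hf using 1
      ring
    · change Λ (a * f + b * g) = 0
      rw [map_add, hΛf, hΛg, add_zero]
  have hle' := Submodule.finrank_mono hle
  rw [Submodule.finrank_map_subtype_eq] at hle'
  rw [hΛ', finrank_top] at hΛr
  rw [Module.finrank_prod] at hφr
  simp only [S, finrank_homogeneousSubmodule_three] at hφr hΛr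
  have hc : ∀ n : ℕ, 2 * (n + 2).choose 2 = (n + 2) * (n + 1) := fun n => by
    rw [Nat.choose_two_right, Nat.mul_div_cancel' (Nat.even_mul_pred_self _).two_dvd]
    rfl
  have h1 := hc m
  have h2 := hc (m + e)
  have h3 := hc (m + d)
  have h4 := hc (m + d + e)
  nlinarith

/-- The derivative of a polynomial in the constant direction `w`. -/
def dirDeriv (w : Fin 3 → K) :
    Derivation K (MvPolynomial (Fin 3) K) (MvPolynomial (Fin 3) K) :=
  ∑ i, w i • pderiv i

lemma eval_dirDeriv (v w : Fin 3 → K) (f : MvPolynomial (Fin 3) K) :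
    eval v (dirDeriv w f) = ∑ i, eval v (pderiv i f) * w i := by
  simp [dirDeriv, Fin.sum_univ_three, mul_comm]

/-- The linear form with coefficient vector `c`. -/
def linForm (c : Fin 3 → K) : MvPolynomial (Fin 3) K := ∑ i, C (c i) * X i

lemma isHomogeneous_linForm (c : Fin 3 → K) : (linForm c).IsHomogeneous 1 :=
  IsHomogeneous.sum _ _ _ fun i _ => isHomogeneous_C_mul_X (c i) i

lemma eval_linForm (c v : Fin 3 → K) : eval v (linForm c) = ∑ i, c i * v i := by
  simp [linForm]

lemma eval_dirDeriv_linForm (c v w : Fin 3 → K) :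
    eval v (dirDeriv w (linForm c)) = ∑ i, c i * w i := by
  rw [eval_dirDeriv]
  refine Finset.sum_congr rfl fun i _ => ?_
  simp [linForm, Pi.single_apply]

/-- A vector outside a line through the origin is separated from it by a linear form. -/
lemma exists_linForm_separating {v w : Fin 3 → K} (h : ∀ c : K, v ≠ c • w) :
    ∃ c : Fin 3 → K, ∑ i, c i * v i = 1 ∧ ∑ i, c i * w i = 0 := by
  have hv : v ∉ Submodule.span K {w} := by
    rw [Submodule.mem_span_singleton]
    rintro ⟨c, hc⟩
    exact h c hc.symm
  obtain ⟨l, hl, hker⟩ := Submodule.exists_le_ker_of_notMem hv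
  have hsum : ∀ x, l x = ∑ i, l (Pi.single i 1) * x i := fun x => by
    rw [LinearMap.pi_apply_eq_sum_univ l x]
    refine Finset.sum_congr rfl fun i _ => ?_
    rw [smul_eq_mul, mul_comm]
    congr 2
    ext j
    simp [Pi.single_apply, eq_comm]
  refine ⟨fun i => (l v)⁻¹ * l (Pi.single i 1), ?_, ?_⟩
  · simp_rw [mul_assoc]
    rw [← Finset.mul_sum, ← hsum, inv_mul_cancel₀ hl]
  · simp_rw [mul_assoc]
    rw [← Finset.mul_sum, ← hsum, hker (Submodule.mem_span_singleton_self w), mul_zero]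

/-- Interpolation of a value and a directional derivative at one vector, by a multiple of a form
that does not vanish there. -/
lemma exists_isHomogeneous_interpolation {k n : ℕ} (hkn : k < n) {A : MvPolynomial (Fin 3) K}
    (hA : A.IsHomogeneous k) {v w : Fin 3 → K} (hv : v ≠ 0) (hvw : ∀ c : K, w ≠ c • v)
    (hAv : eval v A ≠ 0) (α β : K) :
    ∃ s : MvPolynomial (Fin 3) K, s.IsHomogeneous n ∧ A ∣ s ∧ eval v s = α ∧
      eval v (dirDeriv w s) = β := by
  obtain ⟨j, rfl⟩ : ∃ j, n = k + (j + 1) := ⟨n - k - 1, by omega⟩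
  have hwv : ∀ c : K, v ≠ c • w := by
    intro c hc
    have hc0 : c ≠ 0 := fun h => hv (by rw [hc, h, zero_smul])
    exact hvw c⁻¹ (by rw [hc, smul_smul, inv_mul_cancel₀ hc0, one_smul])
  obtain ⟨a, hav, haw⟩ := exists_linForm_separating hwv
  obtain ⟨b, hbw, hbv⟩ := exists_linForm_separating hvw
  set x := α / eval v A with hx
  set y := (β - x * eval v (dirDeriv w A)) / eval v A with hy
  refine ⟨A * (linForm a ^ j * (C x * linForm a + C y * linForm b)), ?_, dvd_mul_right _ _, ?_, ?_⟩
  · refine hA.mul ?_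
    have h1 := (isHomogeneous_linForm a).pow j
    rw [one_mul] at h1
    exact h1.mul (((isHomogeneous_linForm a).C_mul x).add ((isHomogeneous_linForm b).C_mul y))
  · simp only [map_mul, map_add, map_pow, eval_C, eval_linForm, hav, hbv]
    rw [hx]
    field_simp
    ring
  · simp only [Derivation.leibniz, Derivation.leibniz_pow, smul_eq_mul, map_mul, map_add,
      map_pow, eval_linForm, eval_dirDeriv_linForm, hav, hbv, haw, hbw,
      Derivation.map_algebraMap, ← algebraMap_eq, map_zero, nsmul_eq_mul, map_natCast]
    simp only [algebraMap_eq, eval_C]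
    rw [hy]
    field_simp
    ring

/-- A weak form of Bézout's inequality: the common zeros of two coprime plane forms, where the
zeros in `T` are counted twice because both forms vanish there to first order along a common
direction `w`. -/
lemma card_add_card_le_mul {d e : ℕ} {f g : MvPolynomial (Fin 3) K}
    (hf0 : f ≠ 0) (hf : f.IsHomogeneous d) (hg : g.IsHomogeneous e) (hfg : IsRelPrime f g)
    (Z T : Finset (ProjPlane K)) (hTZ : T ⊆ Z)
    (hZf : ∀ P ∈ Z, eval P.rep f = 0) (hZg : ∀ P ∈ Z, eval P.rep g = 0)
    (hT : ∀ P ∈ T, ∃ w : Fin 3 → K, (∀ c : K, w ≠ c • P.rep) ∧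
      eval P.rep (dirDeriv w f) = 0 ∧ eval P.rep (dirDeriv w g) = 0) :
    Z.card + T.card ≤ d * e := by
  classical
  have hW : ∀ P : ProjPlane K, ∃ w : Fin 3 → K, (∀ c : K, w ≠ c • P.rep) ∧
      (P ∈ T → eval P.rep (dirDeriv w f) = 0 ∧ eval P.rep (dirDeriv w g) = 0) := by
    intro P
    by_cases hP : P ∈ T
    · obtain ⟨w, h1, h2⟩ := hT P hP
      exact ⟨w, h1, fun _ => h2⟩
    · suffices h : ∃ w : Fin 3 → K, w ∉ Submodule.span K {P.rep} by
        obtain ⟨w, hw⟩ := h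
        refine ⟨w, fun c hc => hw (Submodule.mem_span_singleton.mpr ⟨c, hc.symm⟩),
          fun h => absurd h hP⟩
      by_contra! h
      have h1 : Submodule.span K {P.rep} = ⊤ := Submodule.eq_top_iff'.mpr h
      have h2 := finrank_span_singleton (K := K) P.rep_nonzero
      rw [h1, finrank_top, Module.finrank_fin_fun] at h2
      omega
  choose w hw hwT using hW
  let Λ : MvPolynomial (Fin 3) K →ₗ[K] (Z → K) × (T → K) :=
    (LinearMap.pi fun P : Z => (aeval P.1.rep).toLinearMap).prod
      (LinearMap.pi fun P : T => (aeval P.1.rep).toLinearMap.comp (dirDeriv (w P.1)).toLinearMap)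
  have hΛ : ∀ s, Λ s = (fun P => eval P.1.rep s, fun P => eval P.1.rep (dirDeriv (w P.1) s)) :=
    fun s => by
      refine Prod.ext (funext fun P => ?_) (funext fun P => ?_) <;>
        simp [Λ, aeval_eq_eval]
  have hcard : Module.finrank K ((Z → K) × (T → K)) = Z.card + T.card := by
    simp [Module.finrank_prod]
  rw [← hcard]
  refine finrank_le_mul_of_isRelPrime hf0 hf hg hfg Λ ?_ ?_ (2 * Z.card) ?_
  · intro a
    rw [hΛ]
    refine Prod.ext (funext fun P => ?_) (funext fun P => ?_)
    · simp [hZf P.1 P.2]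
    · simp [hZf P.1 (hTZ P.2), (hwT P.1 P.2).1]
  · intro a
    rw [hΛ]
    refine Prod.ext (funext fun P => ?_) (funext fun P => ?_)
    · simp [hZg P.1 P.2]
    · simp [hZg P.1 (hTZ P.2), (hwT P.1 P.2).2]
  · rintro ⟨y, y'⟩
    have hsep : ∀ P Q : ProjPlane K, ∃ c : Fin 3 → K, P ≠ Q →
        ∑ i, c i * P.rep i = 1 ∧ ∑ i, c i * Q.rep i = 0 := by
      intro P Q
      by_cases hPQ : P = Q
      · exact ⟨0, fun h => absurd hPQ h⟩
      · obtain ⟨c, hc⟩ := exists_linForm_separating (v := P.rep) (w := Q.rep) fun c hc => hPQ <| by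
          rw [← P.mk_rep, ← Q.mk_rep, Projectivization.mk_eq_mk_iff']
          exact ⟨c, hc.symm⟩
        exact ⟨c, fun _ => hc⟩
    choose c hc using hsep
    have hs : ∀ P ∈ Z, ∃ s : MvPolynomial (Fin 3) K, s.IsHomogeneous (2 * Z.card + d + e) ∧
        (∏ Q ∈ Z.erase P, linForm (c P Q) ^ 2) ∣ s ∧
        eval P.rep s = (if h : P ∈ Z then y ⟨P, h⟩ else 0) ∧
        eval P.rep (dirDeriv (w P) s) = (if h : P ∈ T then y' ⟨P, h⟩ else 0) := by
      intro P hP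
      have hpos : 0 < Z.card := Finset.card_pos.mpr ⟨P, hP⟩
      refine exists_isHomogeneous_interpolation (k := ∑ Q ∈ Z.erase P, 1 * 2) ?_
        (IsHomogeneous.prod _ _ _ fun Q _ => (isHomogeneous_linForm _).pow 2)
        P.rep_nonzero (hw P) ?_ _ _
      · rw [Finset.sum_const, Finset.card_erase_of_mem hP, smul_eq_mul]
        omega
      · rw [map_prod, Finset.prod_ne_zero_iff]
        intro Q hQ
        rw [map_pow, eval_linForm, (hc P Q (Finset.ne_of_mem_erase hQ).symm).1]
        simp
    choose! s hs hdvd hsv hsw using hs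
    have hzero : ∀ P ∈ Z, ∀ Q ∈ Z, Q ≠ P → eval Q.rep (s P) = 0 ∧
        ∀ u, eval Q.rep (dirDeriv u (s P)) = 0 := by
      intro P hP Q hQ hQP
      obtain ⟨t, ht⟩ := (Finset.dvd_prod_of_mem (fun Q => linForm (c P Q) ^ 2)
        (Finset.mem_erase.mpr ⟨hQP, hQ⟩)).trans (hdvd P hP)
      have h0 : eval Q.rep (linForm (c P Q)) = 0 := by
        rw [eval_linForm, (hc P Q hQP.symm).2]
      rw [ht]
      refine ⟨by simp [h0], fun u => by simp [h0]⟩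
    refine ⟨∑ P ∈ Z, s P, IsHomogeneous.sum _ _ _ hs, ?_⟩
    rw [hΛ]
    refine Prod.ext (funext fun Q => ?_) (funext fun Q => ?_)
    · dsimp only
      rw [map_sum, Finset.sum_eq_single Q.1 (fun P hP hPQ => (hzero P hP Q.1 Q.2 hPQ.symm).1)
        (fun h => absurd Q.2 h), hsv Q.1 Q.2, dif_pos Q.2]
    · dsimp only
      rw [map_sum, map_sum, Finset.sum_eq_single Q.1
        (fun P hP hPQ => (hzero P hP Q.1 (hTZ Q.2) hPQ.symm).2 _)
        (fun h => absurd (hTZ Q.2) h), hsw Q.1 (hTZ Q.2), dif_pos Q.2]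

end IntersectionBound

section Lines

variable {K : Type*} [Field K]

/-- The restriction of `f` to the parametrized line `t ↦ v + t • w`. -/
def lineRestrict (f : MvPolynomial (Fin 3) K) (v w : Fin 3 → K) : Polynomial K :=
  aeval (fun i => Polynomial.C (v i) + Polynomial.X * Polynomial.C (w i)) f

lemma eval_lineRestrict (f : MvPolynomial (Fin 3) K) (v w : Fin 3 → K) (t : K) :
    (lineRestrict f v w).eval t = eval (v + t • w) f := by
  rw [lineRestrict, ← Polynomial.coe_aeval_eq_eval, comp_aeval_apply, aeval_eq_eval]
  congr 2
  ext i
  simp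
  exact mul_comm _ _

lemma derivative_lineRestrict (f : MvPolynomial (Fin 3) K) (v w : Fin 3 → K) :
    Polynomial.derivative (lineRestrict f v w) = lineRestrict (dirDeriv w f) v w := by
  induction f using MvPolynomial.induction_on with
  | C a => simp [lineRestrict, dirDeriv, Fin.sum_univ_three]
  | add p q hp hq =>
    simp only [lineRestrict, map_add] at hp hq ⊢
    rw [hp, hq]
  | mul_X p i hp =>
    have hX : dirDeriv w (X i) = C (w i) := by
      fin_cases i <;> simp [dirDeriv, Fin.sum_univ_three, smul_eq_C_mul, pderiv_X]
    simp only [lineRestrict, map_mul, Derivation.leibniz, smul_eq_mul, map_add, aeval_X,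
      Polynomial.derivative_mul, hX, aeval_C] at hp ⊢
    rw [hp]
    simp
    ring

lemma sum_eq_of_mem_support {d : ℕ} {f : MvPolynomial (Fin 3) K} (hf : f.IsHomogeneous d)
    {s : Fin 3 →₀ ℕ} (hs : s ∈ f.support) : ∑ i, s i = d := by
  rw [← Finsupp.degree_eq_sum, Finsupp.degree_apply, ← hf.degree_eq_sum_deg_support hs]

lemma natDegree_C_add_X_mul_C_le (a b : K) :
    (Polynomial.C a + Polynomial.X * Polynomial.C b).natDegree ≤ 1 := by
  compute_degree

lemma natDegree_lineRestrict_le {d : ℕ} {f : MvPolynomial (Fin 3) K} (hf : f.IsHomogeneous d)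
    (v w : Fin 3 → K) : (lineRestrict f v w).natDegree ≤ d := by
  rw [lineRestrict, aeval_def, eval₂_eq']
  refine Polynomial.natDegree_sum_le_of_forall_le _ _ fun s hs => ?_
  refine (Polynomial.natDegree_C_mul_le _ _).trans ((Polynomial.natDegree_prod_le _ _).trans ?_)
  rw [← sum_eq_of_mem_support hf hs]
  refine Finset.sum_le_sum fun i _ => ?_
  simpa using Polynomial.natDegree_pow_le_of_le (s i) (natDegree_C_add_X_mul_C_le (v i) (w i))

lemma coeff_lineRestrict {d : ℕ} {f : MvPolynomial (Fin 3) K} (hf : f.IsHomogeneous d)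
    (v w : Fin 3 → K) : (lineRestrict f v w).coeff d = eval w f := by
  rw [lineRestrict, aeval_def, eval₂_eq', eval_eq', Polynomial.finsetSum_coeff]
  refine Finset.sum_congr rfl fun s hs => ?_
  have hdeg : ∀ i, ((Polynomial.C (v i) + Polynomial.X * Polynomial.C (w i)) ^ s i).natDegree ≤
      s i := fun i => by
    simpa using Polynomial.natDegree_pow_le_of_le (s i) (natDegree_C_add_X_mul_C_le (v i) (w i))
  have hcoeff : ∀ i, ((Polynomial.C (v i) + Polynomial.X * Polynomial.C (w i)) ^ s i).coeff (s i) =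
      w i ^ s i := fun i => by
    have h := Polynomial.coeff_pow_of_natDegree_le (m := s i)
      (natDegree_C_add_X_mul_C_le (v i) (w i))
    rw [mul_one] at h
    rw [h]
    simp
  rw [← sum_eq_of_mem_support hf hs]
  simp only [Fin.sum_univ_three, Fin.prod_univ_three]
  rw [Polynomial.algebraMap_eq, Polynomial.coeff_C_mul,
    Polynomial.coeff_mul_add_eq_of_natDegree_le (Polynomial.natDegree_mul_le_of_le (hdeg 0) (hdeg 1))
    (hdeg 2), Polynomial.coeff_mul_add_eq_of_natDegree_le (hdeg 0) (hdeg 1), hcoeff, hcoeff, hcoeff]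

/-- A form vanishing to second order along a line vanishes to third order there if its second
directional derivative vanishes too. -/
lemma X_pow_three_dvd_lineRestrict (h2 : (2 : K) ≠ 0) {f : MvPolynomial (Fin 3) K}
    {v w : Fin 3 → K} (hf : eval v f = 0) (hf' : eval v (dirDeriv w f) = 0)
    (hf'' : eval v (dirDeriv w (dirDeriv w f)) = 0) :
    Polynomial.X ^ 3 ∣ lineRestrict f v w := by
  have key : ∀ g : MvPolynomial (Fin 3) K, (lineRestrict g v w).coeff 0 = eval v g := fun g => by
    rw [Polynomial.coeff_zero_eq_eval_zero, eval_lineRestrict, zero_smul, add_zero]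
  rw [Polynomial.X_pow_dvd_iff]
  intro n hn
  interval_cases n
  · rw [key, hf]
  · have h := key (dirDeriv w f)
    rw [← derivative_lineRestrict, Polynomial.coeff_derivative, hf'] at h
    simpa using h
  · have h := key (dirDeriv w (dirDeriv w f))
    rw [← derivative_lineRestrict, ← derivative_lineRestrict, Polynomial.coeff_derivative,
      Polynomial.coeff_derivative, hf''] at h
    have h' : (lineRestrict f v w).coeff 2 * 2 = 0 := by
      rw [← h]
      push_cast
      ring
    exact (mul_eq_zero.mp h').resolve_right h2

lemma eval_smul_of_isHomogeneous {d : ℕ} {f : MvPolynomial (Fin 3) K} (hf : f.IsHomogeneous d)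
    (c : K) (v : Fin 3 → K) : eval (c • v) f = c ^ d * eval v f := by
  rw [eval_eq', eval_eq', Finset.mul_sum]
  refine Finset.sum_congr rfl fun s hs => ?_
  simp only [Pi.smul_apply, smul_eq_mul, mul_pow, Finset.prod_mul_distrib,
    Finset.prod_pow_eq_pow_sum, sum_eq_of_mem_support hf hs]
  ring

/-- A form of positive degree has infinitely many projective zeros. -/
lemma infinite_zeros_of_isHomogeneous [IsAlgClosed K] {m : ℕ} (hm : 0 < m)
    {h : MvPolynomial (Fin 3) K} (h0 : h ≠ 0) (hh : h.IsHomogeneous m) :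
    {P : ProjPlane K | eval P.rep h = 0}.Infinite := by
  classical
  intro hfin
  obtain ⟨u, hu⟩ : ∃ u, eval u h ≠ 0 := by
    by_contra! hall
    exact h0 (hh.eq_zero_of_forall_eval_eq_zero hall)
  let s : Finset (Subspace K (Fin 3 → K)) :=
    insert (Submodule.span K {u, u}) (hfin.toFinset.image fun P => Submodule.span K {u, P.rep})
  have hs : ⊤ ∉ s := by
    have hspan : ∀ x : Fin 3 → K, Submodule.span K {u, x} ≠ ⊤ := by
      intro x hx
      have h1 := finrank_span_le_card (R := K) ({u, x} : Set (Fin 3 → K))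
      rw [hx, finrank_top, Module.finrank_fin_fun] at h1
      have h2 : ({u, x} : Set (Fin 3 → K)).toFinset.card ≤ 2 := by
        rw [Set.toFinset_insert, Set.toFinset_singleton]
        exact Finset.card_le_two
      omega
    simp only [s, Finset.mem_insert, Finset.mem_image, not_or, not_exists, not_and]
    exact ⟨fun h => hspan _ h.symm, fun P _ => hspan _⟩
  have hne := Subspace.biUnion_ne_univ_of_top_notMem hs
  obtain ⟨v, hv⟩ := (Set.ne_univ_iff_exists_notMem _).mp hne
  simp only [Set.mem_iUnion, not_exists] at hv
  have hdeg : (lineRestrict h v u).degree ≠ 0 := by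
    intro hd
    have h1 := coeff_lineRestrict hh v u
    rw [Polynomial.eq_C_of_degree_eq_zero hd, Polynomial.coeff_C_of_ne_zero hm.ne'] at h1
    exact hu h1.symm
  obtain ⟨t, ht⟩ := IsAlgClosed.exists_root _ hdeg
  rw [Polynomial.IsRoot, eval_lineRestrict] at ht
  have hvt : v + t • u ≠ 0 := by
    intro h
    refine hv _ (Finset.mem_insert_self _ _) ?_
    refine Submodule.mem_span_pair.mpr ⟨-t, 0, ?_⟩
    rw [eq_neg_of_add_eq_zero_left h]
    simp
  obtain ⟨c, hc⟩ := Projectivization.exists_smul_eq_mk_rep K _ hvt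
  refine hv _ (Finset.mem_insert_of_mem (Finset.mem_image_of_mem _ (a := Projectivization.mk K _ hvt)
    (hfin.mem_toFinset.mpr ?_))) ?_
  · rw [Set.mem_ofPred_eq, ← hc, Units.smul_def, eval_smul_of_isHomogeneous hh, ht, mul_zero]
  · refine Submodule.mem_span_pair.mpr ⟨-t, (c⁻¹ : Kˣ), ?_⟩
    rw [← hc, ← Units.smul_def, inv_smul_smul]
    simp

/-- The kernel of a nonzero linear form on three-dimensional space has dimension two. -/
lemma finrank_ker_dotProduct {a : Fin 3 → K} (ha : a ≠ 0) :
    Module.finrank K (LinearMap.ker (dotProductBilin K K a)) = 2 := by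
  have hne : dotProductBilin K K a ≠ 0 := by
    intro h
    refine ha (funext fun i => ?_)
    simpa using LinearMap.congr_fun h (Pi.single i 1)
  have h1 := Module.Dual.finrank_ker_add_one_of_ne_zero (f := dotProductBilin K K a) hne
  rw [Module.finrank_fin_fun] at h1
  omega

/-- On a plane through the origin there is a vector outside a given line. -/
lemma exists_sum_eq_zero_not_smul {a : Fin 3 → K} (ha : a ≠ 0) (v : Fin 3 → K) :
    ∃ w : Fin 3 → K, ∑ i, a i * w i = 0 ∧ ∀ c : K, w ≠ c • v := by
  by_contra! h
  have hle : LinearMap.ker (dotProductBilin K K a) ≤ Submodule.span K {v} := by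
    intro w hw
    obtain ⟨c, hc⟩ := h w hw
    exact Submodule.mem_span_singleton.mpr ⟨c, hc.symm⟩
  have h1 := Submodule.finrank_mono hle
  have h2 := finrank_span_le_card (R := K) ({v} : Set (Fin 3 → K))
  rw [finrank_ker_dotProduct ha] at h1
  simp at h2
  omega

lemma linearIndependent_pair_of_not_smul {v w : Fin 3 → K} (hv : v ≠ 0)
    (hw : ∀ c : K, w ≠ c • v) : LinearIndependent K ![v, w] :=
  (LinearIndependent.pair_iff' hv).mpr fun c hc => hw c hc.symm

/-- Every vector of a plane is a combination of two independent ones. -/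
lemma exists_smul_add_smul_of_sum_eq_zero {a : Fin 3 → K} (ha : a ≠ 0) {u v x : Fin 3 → K}
    (hu0 : u ≠ 0) (hvu : ∀ c : K, v ≠ c • u) (hu : ∑ i, a i * u i = 0)
    (hv : ∑ i, a i * v i = 0) (hx : ∑ i, a i * x i = 0) : ∃ α β : K, α • v + β • u = x := by
  have hle : Submodule.span K {u, v} ≤ LinearMap.ker (dotProductBilin K K a) := by
    rw [Submodule.span_le]
    rintro y (rfl | rfl)
    · exact hu
    · exact hv
  have hfin : Module.finrank K (Submodule.span K {u, v}) = 2 := by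
    have h := finrank_span_eq_card (linearIndependent_pair_of_not_smul hu0 hvu)
    rw [Matrix.range_cons_cons_empty] at h
    simpa using h
  have heq := Submodule.eq_of_le_of_finrank_eq hle (hfin.trans (finrank_ker_dotProduct ha).symm)
  have hx' : x ∈ Submodule.span K {u, v} := by
    rw [heq]
    exact hx
  obtain ⟨β, α, h⟩ := Submodule.mem_span_pair.mp hx'
  exact ⟨α, β, by rw [← h, add_comm]⟩

/-- Two nonzero linear forms vanishing on the same plane are proportional. -/
lemma exists_proportional_of_sum_eq_zero {a b : Fin 3 → K} (ha0 : a ≠ 0) (hb0 : b ≠ 0)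
    {u v : Fin 3 → K} (hu0 : u ≠ 0) (hvu : ∀ c : K, v ≠ c • u)
    (hau : ∑ i, a i * u i = 0) (hav : ∑ i, a i * v i = 0)
    (hbu : ∑ i, b i * u i = 0) (hbv : ∑ i, b i * v i = 0) :
    ∃ c : K, c ≠ 0 ∧ ∀ i, a i = c * b i := by
  by_cases h : ∃ c : K, a = c • b
  · obtain ⟨c, rfl⟩ := h
    refine ⟨c, fun hc => ha0 (by rw [hc, zero_smul]), fun i => rfl⟩
  · push Not at h
    obtain ⟨x, hxa, hxb⟩ := exists_linForm_separating h
    have hbx : ∑ i, b i * x i = 0 := by simpa only [mul_comm] using hxb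
    obtain ⟨α, β, rfl⟩ := exists_smul_add_smul_of_sum_eq_zero hb0 hu0 hvu hbu hbv hbx
    exfalso
    refine one_ne_zero (hxa.symm.trans ?_)
    simp only [Fin.sum_univ_three, Pi.add_apply, Pi.smul_apply, smul_eq_mul] at hau hav ⊢
    linear_combination α * hav + β * hau

lemma eval_dirDeriv_self {d : ℕ} {f : MvPolynomial (Fin 3) K} (hf : f.IsHomogeneous d)
    (v : Fin 3 → K) : eval v (dirDeriv v f) = d * eval v f := by
  have h := congrArg (eval v) hf.sum_X_mul_pderiv
  rw [eval_dirDeriv]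
  simpa [mul_comm] using h

/-- A line that does not meet a smooth curve of degree `d` in exactly `d` points is tangent to
the curve at some point. -/
lemma exists_tangent_of_ncard_ne [IsAlgClosed K] {d : ℕ} {f : MvPolynomial (Fin 3) K}
    (hf : f.IsHomogeneous d)
    (hsm : ∀ v : Fin 3 → K, v ≠ 0 → eval v f = 0 → (fun i => eval v (pderiv i f)) ≠ 0)
    {a : Fin 3 → K} (ha : a ≠ 0)
    (hcard : {P : ProjPlane K | eval P.rep f = 0 ∧ ∑ i, a i * P.rep i = 0}.ncard ≠ d) :
    ∃ v : Fin 3 → K, v ≠ 0 ∧ eval v f = 0 ∧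
      ∃ c : K, c ≠ 0 ∧ ∀ i, a i = c * eval v (pderiv i f) := by
  classical
  have htangent : ∀ u v : Fin 3 → K, v ≠ 0 → (∀ c : K, u ≠ c • v) → ∑ i, a i * v i = 0 →
      ∑ i, a i * u i = 0 → eval v f = 0 → eval v (dirDeriv u f) = 0 →
      ∃ v : Fin 3 → K, v ≠ 0 ∧ eval v f = 0 ∧
        ∃ c : K, c ≠ 0 ∧ ∀ i, a i = c * eval v (pderiv i f) := by
    intro u v hv huv hav hau hfv hfu
    refine ⟨v, hv, hfv, exists_proportional_of_sum_eq_zero ha (hsm v hv hfv) hv huv hav hau ?_ ?_⟩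
    · rw [← eval_dirDeriv, eval_dirDeriv_self hf, hfv, mul_zero]
    · rw [← eval_dirDeriv, hfu]
  by_cases hex : ∃ u : Fin 3 → K, u ≠ 0 ∧ ∑ i, a i * u i = 0 ∧ eval u f ≠ 0
  · obtain ⟨u, hu0, hau, hfu⟩ := hex
    obtain ⟨v, hav, hvu⟩ := exists_sum_eq_zero_not_smul ha u
    set φ := lineRestrict f v u with hφ
    have hφe : ∀ t, φ.eval t = eval (v + t • u) f := eval_lineRestrict f v u
    have hφd : φ.coeff d ≠ 0 := by rwa [hφ, coeff_lineRestrict hf]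
    have hφ0 : φ ≠ 0 := fun h => hφd (by rw [h, Polynomial.coeff_zero])
    have hdeg : φ.natDegree = d :=
      le_antisymm (natDegree_lineRestrict_le hf v u) (Polynomial.le_natDegree_of_ne_zero hφd)
    have hpt0 : ∀ t : K, v + t • u ≠ 0 := fun t h =>
      hvu (-t) (by rw [eq_neg_of_add_eq_zero_left h, neg_smul])
    by_cases hnd : φ.roots.Nodup
    · exfalso
      apply hcard
      have himage : {P : ProjPlane K | eval P.rep f = 0 ∧ ∑ i, a i * P.rep i = 0} =
          (fun t => Projectivization.mk K (v + t • u) (hpt0 t)) '' (φ.roots.toFinset : Set K) := by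
        ext P
        simp only [Set.mem_ofPred_eq, Set.mem_image, Finset.mem_coe, Multiset.mem_toFinset,
          Polynomial.mem_roots hφ0, Polynomial.IsRoot, hφe]
        constructor
        · rintro ⟨hfP, haP⟩
          obtain ⟨α, β, hP⟩ := exists_smul_add_smul_of_sum_eq_zero ha hu0 hvu hau hav haP
          have hα : α ≠ 0 := by
            rintro rfl
            rw [zero_smul, zero_add] at hP
            have hβ : β ≠ 0 := fun h => P.rep_nonzero (by rw [← hP, h, zero_smul])
            rw [← hP, eval_smul_of_isHomogeneous hf] at hfP
            exact mul_ne_zero (pow_ne_zero _ hβ) hfu hfP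
          have hP' : P.rep = α • (v + (β / α) • u) := by
            rw [← hP, smul_add, smul_smul, mul_div_cancel₀ _ hα]
          refine ⟨β / α, ?_, ?_⟩
          · rw [hP', eval_smul_of_isHomogeneous hf] at hfP
            exact (mul_eq_zero.mp hfP).resolve_left (pow_ne_zero _ hα)
          · conv_rhs => rw [← P.mk_rep]
            rw [Projectivization.mk_eq_mk_iff']
            exact ⟨α⁻¹, by rw [hP', smul_smul, inv_mul_cancel₀ hα, one_smul]⟩
        · rintro ⟨t, ht, rfl⟩
          obtain ⟨c, hc⟩ := Projectivization.exists_smul_eq_mk_rep K _ (hpt0 t)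
          rw [← hc, Units.smul_def, eval_smul_of_isHomogeneous hf, ht, mul_zero]
          refine ⟨rfl, ?_⟩
          simp only [Fin.sum_univ_three, Pi.add_apply, Pi.smul_apply, smul_eq_mul] at hau hav ⊢
          linear_combination c * hav + c * t * hau
      rw [himage, Set.ncard_image_of_injective, Set.ncard_coe_finset,
        Multiset.toFinset_card_of_nodup hnd, IsAlgClosed.card_roots_eq_natDegree, hdeg]
      intro s t hst
      obtain ⟨c, hc⟩ := (Projectivization.mk_eq_mk_iff' K _ _ _ _).mp hst
      by_contra hne
      have hc1 : (1 - c) • v = (c * t - s) • u := by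
        have : v + s • u = c • v + (c * t) • u := by rw [← hc, smul_add, smul_smul]
        rw [sub_smul, sub_smul, one_smul, sub_eq_sub_iff_add_eq_add, this, add_comm]
      by_cases h1 : 1 - c = 0
      · rw [h1, zero_smul, eq_comm, smul_eq_zero] at hc1
        have hc' : c = 1 := (sub_eq_zero.mp h1).symm
        rw [hc', one_mul, sub_eq_zero] at hc1
        exact hne (hc1.resolve_right hu0).symm
      · refine hvu ((1 - c)⁻¹ * (c * t - s)) ?_
        rw [mul_smul, ← hc1, smul_smul, inv_mul_cancel₀ h1, one_smul]
    · rw [Multiset.nodup_iff_count_le_one] at hnd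
      push Not at hnd
      obtain ⟨t, ht⟩ := hnd
      rw [Polynomial.count_roots, Polynomial.one_lt_rootMultiplicity_iff_isRoot hφ0] at ht
      obtain ⟨h1, h2⟩ := ht
      rw [Polynomial.IsRoot, hφ, eval_lineRestrict] at h1
      rw [Polynomial.IsRoot, hφ, derivative_lineRestrict, eval_lineRestrict] at h2
      refine htangent u (v + t • u) (hpt0 t) ?_ ?_ hau h1 h2
      · intro c hc
        have hc0 : c ≠ 0 := by
          rintro rfl
          exact hu0 (by rw [hc, zero_smul])
        refine hvu (c⁻¹ - t) ?_
        have : c⁻¹ • u = v + t • u := by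
          conv_lhs => rw [hc, smul_smul, inv_mul_cancel₀ hc0, one_smul]
        rw [sub_smul, this, add_sub_cancel_right]
      · simp only [Fin.sum_univ_three, Pi.add_apply, Pi.smul_apply, smul_eq_mul] at hau hav ⊢
        linear_combination hav + t * hau
  · push Not at hex
    obtain ⟨v, hav, hv⟩ := exists_sum_eq_zero_not_smul ha 0
    have hv0 : v ≠ 0 := by simpa using hv 0
    obtain ⟨u, hau, huv⟩ := exists_sum_eq_zero_not_smul ha v
    have hzero : lineRestrict f v u = 0 := by
      refine Polynomial.funext fun t => ?_
      rw [eval_lineRestrict, Polynomial.eval_zero]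
      refine hex _ ?_ ?_
      · intro h
        by_cases ht : t = 0
        · rw [ht, zero_smul, add_zero] at h
          exact hv0 h
        · refine huv (-t⁻¹) ?_
          rw [eq_neg_of_add_eq_zero_left h, neg_smul_neg, smul_smul, inv_mul_cancel₀ ht, one_smul]
      · simp only [Fin.sum_univ_three, Pi.add_apply, Pi.smul_apply, smul_eq_mul] at hau hav ⊢
        linear_combination hav + t * hau
    refine htangent u v hv0 huv hav hau (hex v hv0 hav) ?_
    have h := eval_lineRestrict (dirDeriv u f) v u 0
    rw [← derivative_lineRestrict, hzero, zero_smul, add_zero] at h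
    simpa using h.symm

end Lines

section FrobeniusForm

variable {K : Type*} [Field K]

/-- The form `∑ ∂ᵢf · xᵢ ^ q`, which vanishes at a point of the curve `f` exactly when the tangent
line there contains the image of the point under the `q`-power Frobenius. -/
def frobForm (q : ℕ) (f : MvPolynomial (Fin 3) K) : MvPolynomial (Fin 3) K :=
  ∑ i, pderiv i f * X i ^ q

lemma isHomogeneous_frobForm {d : ℕ} {f : MvPolynomial (Fin 3) K} (hf : f.IsHomogeneous d)
    (q : ℕ) : (frobForm q f).IsHomogeneous (d - 1 + q) :=
  IsHomogeneous.sum _ _ _ fun i _ => hf.pderiv.mul (isHomogeneous_X_pow i q)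

lemma eval_frobForm (q : ℕ) (f : MvPolynomial (Fin 3) K) (v : Fin 3 → K) :
    eval v (frobForm q f) = ∑ i, eval v (pderiv i f) * v i ^ q := by
  simp [frobForm]

lemma eval_dirDeriv_frobForm {q : ℕ} (hq : (q : K) = 0) (f : MvPolynomial (Fin 3) K)
    (v w : Fin 3 → K) :
    eval v (dirDeriv w (frobForm q f)) = ∑ i, eval v (dirDeriv w (pderiv i f)) * v i ^ q := by
  rw [frobForm, map_sum, map_sum]
  refine Finset.sum_congr rfl fun i _ => ?_
  simp [hq, mul_comm]

/-- If `f` and its Frobenius form have a common factor, then at the zeros of this factor the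
second derivative of `f` in the direction of the Frobenius image vanishes. -/
lemma eval_dirDeriv_dirDeriv_eq_zero {q : ℕ} (hq : (q : K) = 0) {f k : MvPolynomial (Fin 3) K}
    {v : Fin 3 → K} (hsm : (fun i => eval v (pderiv i f)) ≠ 0) (hkf : k ∣ f)
    (hkg : k ∣ frobForm q f) (hk : eval v k = 0) :
    eval v (dirDeriv (fun i => v i ^ q) (dirDeriv (fun i => v i ^ q) f)) = 0 := by
  have hg : eval v (dirDeriv (fun i => v i ^ q) f) = 0 := by
    obtain ⟨l, hl⟩ := hkg
    rw [eval_dirDeriv, ← eval_frobForm, hl, map_mul, hk, zero_mul]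
  have h1 : eval v (dirDeriv (fun i => v i ^ q) (dirDeriv (fun i => v i ^ q) f)) =
      eval v (dirDeriv (fun i => v i ^ q) (frobForm q f)) := by
    rw [eval_dirDeriv_frobForm hq]
    conv_lhs => enter [2, 2]; rw [dirDeriv]
    simp [Fin.sum_univ_three, mul_comm]
  obtain ⟨l, hl⟩ := hkg
  obtain ⟨r, rfl⟩ := hkf
  have hr : eval v r ≠ 0 := by
    intro h0
    refine hsm (funext fun i => ?_)
    simp [hk, h0]
  have hk' : eval v (dirDeriv (fun i => v i ^ q) k) = 0 := by
    simpa [hk, hr] using hg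
  rw [h1, hl]
  simp [hk, hk']

/-- At a point fixed by the Frobenius, the Frobenius form vanishes along the tangent line to
second order. -/
lemma eval_dirDeriv_frobForm_eq_zero {q d : ℕ} (hq : (q : K) = 0) {f : MvPolynomial (Fin 3) K}
    (hf : f.IsHomogeneous d) {v w : Fin 3 → K} {c : K} (hc : ∀ i, v i ^ q = c * v i)
    (hw : eval v (dirDeriv w f) = 0) : eval v (dirDeriv w (frobForm q f)) = 0 := by
  have h := congrArg (fun s => eval v (dirDeriv w s)) hf.sum_X_mul_pderiv
  have hX : ∀ i, dirDeriv w (X i) = C (w i) := fun i => by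
    fin_cases i <;> simp [dirDeriv, Fin.sum_univ_three, smul_eq_C_mul, pderiv_X]
  simp only [map_sum, Derivation.leibniz, map_add, smul_eq_mul, map_mul, eval_X, hX, eval_C,
    map_nsmul, hw, smul_zero, Finset.sum_add_distrib] at h
  rw [eval_dirDeriv] at hw
  rw [hw, add_zero] at h
  rw [eval_dirDeriv_frobForm hq]
  simp_rw [hc]
  rw [← mul_zero c, ← h, Finset.mul_sum]
  exact Finset.sum_congr rfl fun i _ => by ring

lemma frobPt_eq_self_iff (q : ℕ) (P : ProjPlane K) :
    FrobPt q P = P ↔ ∃ c : K, c • P.rep = fun i => P.rep i ^ q := by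
  conv_lhs => rhs; rw [← P.mk_rep]
  rw [FrobPt, Projectivization.mk_eq_mk_iff']

lemma finite_frobPt_eq_self {q : ℕ} (hq : 1 < q) : {P : ProjPlane K | FrobPt q P = P}.Finite := by
  classical
  have hroots : {y : K | y ^ q = y}.Finite := by
    have hne : (Polynomial.X ^ q - Polynomial.X : Polynomial K) ≠ 0 :=
      FiniteField.X_pow_card_sub_X_ne_zero K hq
    refine (Polynomial.X ^ q - Polynomial.X : Polynomial K).roots.toFinset.finite_toSet.subset
      fun y hy => ?_
    simp [hne, sub_eq_zero.mpr (show y ^ q = y from hy)]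
  have hi : ∀ P : ProjPlane K, ∃ i, P.rep i ≠ 0 := fun P => by
    by_contra! h
    exact P.rep_nonzero (funext h)
  choose i hi using hi
  refine Set.Finite.of_injOn (f := fun P => (P.rep (i P))⁻¹ • P.rep)
    (t := {x : Fin 3 → K | ∀ j, x j ∈ {y : K | y ^ q = y}}) ?_ ?_ (Set.Finite.pi' fun _ => hroots)
  · intro P hP j
    obtain ⟨c, hc⟩ := (frobPt_eq_self_iff q P).mp hP
    have h1 := congrFun hc (i P)
    have h2 := congrFun hc j
    simp only [Pi.smul_apply, smul_eq_mul] at h1 h2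
    have hcne : c ≠ 0 := by
      rintro rfl
      rw [zero_mul, eq_comm] at h1
      exact hi P (pow_eq_zero_iff (by omega) |>.mp h1)
    have hPi := hi P
    simp only [Set.mem_ofPred_eq, Pi.smul_apply, smul_eq_mul, mul_pow, inv_pow]
    rw [← h1, ← h2]
    field_simp
  · intro P _ Q _ hPQ
    rw [← P.mk_rep, ← Q.mk_rep, Projectivization.mk_eq_mk_iff']
    refine ⟨P.rep (i P) * (Q.rep (i Q))⁻¹, ?_⟩
    dsimp only at hPQ
    rw [mul_smul, ← hPQ, smul_smul, mul_inv_cancel₀ (hi P), one_smul]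

end FrobeniusForm

section Tangents

variable {f : MvPolynomial (Fin 3) F} {d : ℕ}

lemma aeval_eq_eval_map (v : Fin 3 → AlgebraicClosure F) (f : MvPolynomial (Fin 3) F) :
    aeval v f = eval v (map (algebraMap F (AlgebraicClosure F)) f) := by
  rw [aeval_def, eval_map]

lemma isTangentAt_mk (hf : f.IsHomogeneous d) {a : Fin 3 → F} {v : Fin 3 → AlgebraicClosure F}
    (hv : v ≠ 0) (hfv : aeval v f = 0) {c : AlgebraicClosure F} (hc : c ≠ 0)
    (ha : ∀ i, algebraMap F (AlgebraicClosure F) (a i) = c * aeval v (pderiv i f)) :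
    IsTangentAt f a (Projectivization.mk _ v hv) := by
  obtain ⟨u, hu⟩ := Projectivization.exists_smul_eq_mk_rep (AlgebraicClosure F) v hv
  have key : ∀ {n : ℕ} {g : MvPolynomial (Fin 3) F}, g.IsHomogeneous n →
      aeval (Projectivization.mk (AlgebraicClosure F) v hv).rep g =
        (u : AlgebraicClosure F) ^ n * aeval v g := fun hg => by
    rw [← hu, Units.smul_def, aeval_eq_eval_map, aeval_eq_eval_map,
      eval_smul_of_isHomogeneous (hg.map _)]
  refine ⟨by rw [OnCurve, key hf, hfv, mul_zero],
    c * ((u : AlgebraicClosure F) ^ (d - 1))⁻¹, by simp [hc], fun i => ?_⟩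
  have hu0 : (u : AlgebraicClosure F) ^ (d - 1) ≠ 0 := by simp
  rw [key hf.pderiv, ha i]
  field_simp

lemma IsTangentAt.unique {ℓ ℓ' : ProjPlane F} {P : ProjPlane (AlgebraicClosure F)}
    (h : IsTangentAt f ℓ.rep P) (h' : IsTangentAt f ℓ'.rep P) : ℓ = ℓ' := by
  obtain ⟨_, c, hc, ha⟩ := h
  obtain ⟨_, c', hc', ha'⟩ := h'
  obtain ⟨i, hi⟩ : ∃ i, ℓ'.rep i ≠ 0 := by
    by_contra! h
    exact ℓ'.rep_nonzero (funext h)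
  rw [← ℓ.mk_rep, ← ℓ'.mk_rep, Projectivization.mk_eq_mk_iff']
  refine ⟨ℓ.rep i / ℓ'.rep i, funext fun j => ?_⟩
  rw [Pi.smul_apply, smul_eq_mul, div_mul_eq_mul_div, div_eq_iff hi]
  apply (algebraMap F (AlgebraicClosure F)).injective
  rw [map_mul, map_mul, ha, ha', ha, ha']
  ring

/-- A line that is not transverse to a smooth curve is tangent to it at some point. -/
lemma exists_isTangentAt_of_not_transverse (hf : f.IsHomogeneous d) (hsmooth : SmoothCurve f)
    {a : Fin 3 → F} (ha : a ≠ 0) (h : ¬ Transverse f a d) : ∃ P, IsTangentAt f a P := by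
  have ha' : (fun i => algebraMap F (AlgebraicClosure F) (a i)) ≠ 0 := fun h0 =>
    ha (funext fun i => by simpa using congrFun h0 i)
  have hsm : ∀ v : Fin 3 → AlgebraicClosure F, v ≠ 0 →
      eval v (map (algebraMap F (AlgebraicClosure F)) f) = 0 →
      (fun i => eval v (pderiv i (map (algebraMap F (AlgebraicClosure F)) f))) ≠ 0 := by
    intro v hv hfv h0
    obtain ⟨u, hu⟩ := Projectivization.exists_smul_eq_mk_rep (AlgebraicClosure F) v hv
    have hcurve : OnCurve f (Projectivization.mk _ v hv) := by
      rw [OnCurve, aeval_eq_eval_map, ← hu, Units.smul_def,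
        eval_smul_of_isHomogeneous (hf.map _), hfv, mul_zero]
    obtain ⟨i, hi⟩ := hsmooth _ hcurve
    refine hi ?_
    rw [aeval_eq_eval_map, ← pderiv_map, ← hu, Units.smul_def,
      eval_smul_of_isHomogeneous (hf.map _).pderiv]
    rw [show eval v (pderiv i _) = 0 from congrFun h0 i, mul_zero]
  obtain ⟨v, hv, hfv, c, hc, hac⟩ := exists_tangent_of_ncard_ne (hf.map _) hsm ha' fun hcard =>
    h (by
      rw [← hcard, Transverse]
      simp only [OnCurve, OnLine, aeval_eq_eval_map])
  refine ⟨_, isTangentAt_mk hf hv ((aeval_eq_eval_map _ _).trans hfv) hc fun i => ?_⟩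
  rw [hac, pderiv_map, aeval_eq_eval_map]

variable [Fintype F]

lemma aeval_pow_card (v : Fin 3 → AlgebraicClosure F) (f : MvPolynomial (Fin 3) F) :
    aeval (fun i => v i ^ Fintype.card F) f = (aeval v f) ^ Fintype.card F := by
  have h := comp_aeval_apply v (FiniteField.frobeniusAlgHom F (AlgebraicClosure F)) f
  simpa using h.symm

lemma algebraMap_pow_card (a : F) :
    algebraMap F (AlgebraicClosure F) a ^ Fintype.card F = algebraMap F (AlgebraicClosure F) a := by
  rw [← map_pow, FiniteField.pow_card]

lemma IsTangentAt.frobPt (hf : f.IsHomogeneous d) {a : Fin 3 → F}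
    {P : ProjPlane (AlgebraicClosure F)} (h : IsTangentAt f a P) :
    IsTangentAt f a (FrobPt (Fintype.card F) P) := by
  obtain ⟨hP, c, hc, ha⟩ := h
  refine isTangentAt_mk hf _ (c := c ^ Fintype.card F) ?_ (pow_ne_zero _ hc) fun i => ?_
  · rw [aeval_pow_card, hP, zero_pow Fintype.card_ne_zero]
  · rw [aeval_pow_card, ← mul_pow, ← ha, algebraMap_pow_card]

lemma IsTangentAt.eval_frobForm_eq_zero (hf : f.IsHomogeneous d) {a : Fin 3 → F}
    {P : ProjPlane (AlgebraicClosure F)} (h : IsTangentAt f a P) :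
    eval P.rep (frobForm (Fintype.card F) (map (algebraMap F (AlgebraicClosure F)) f)) = 0 := by
  obtain ⟨hP, c, hc, ha⟩ := h
  have h1 : ∑ i, algebraMap F (AlgebraicClosure F) (a i) * P.rep i = 0 := by
    have := eval_dirDeriv_self (hf.map (algebraMap F (AlgebraicClosure F))) P.rep
    rw [← aeval_eq_eval_map, hP, mul_zero, eval_dirDeriv] at this
    simp_rw [pderiv_map, ← aeval_eq_eval_map] at this
    simp_rw [ha, mul_assoc]
    rw [← Finset.mul_sum, this, mul_zero]
  have h2 := congrArg (FiniteField.frobeniusAlgHom F (AlgebraicClosure F)) h1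
  simp only [map_sum, map_mul, map_zero, FiniteField.frobeniusAlgHom_apply, AlgHom.commutes] at h2
  rw [eval_frobForm]
  simp_rw [pderiv_map, ← aeval_eq_eval_map]
  refine (mul_eq_zero.mp ?_).resolve_left hc
  rw [Finset.mul_sum, ← h2]
  refine Finset.sum_congr rfl fun i _ => ?_
  rw [← mul_assoc, ← ha]

/-- If every line is tangent to the curve, counting tangency points gives a lower bound for the
number of common zeros of the curve and its Frobenius form. -/
lemma two_mul_card_le_mul (hq : (Fintype.card F : AlgebraicClosure F) = 0)
    (hf0 : f ≠ 0) (hf : f.IsHomogeneous d) (hsmooth : SmoothCurve f)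
    (hrel : IsRelPrime (map (algebraMap F (AlgebraicClosure F)) f)
      (frobForm (Fintype.card F) (map (algebraMap F (AlgebraicClosure F)) f)))
    (htan : ∀ ℓ : ProjPlane F, ∃ P, IsTangentAt f ℓ.rep P) :
    2 * Nat.card (ProjPlane F) ≤ d * (d - 1 + Fintype.card F) := by
  classical
  set f' := map (algebraMap F (AlgebraicClosure F)) f with hf'
  have hf'h : f'.IsHomogeneous d := hf.map _
  have hf'0 : f' ≠ 0 := by
    rwa [hf', Ne, map_eq_zero_iff _ (map_injective _ (algebraMap F (AlgebraicClosure F)).injective)]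
  have : Fintype (ProjPlane F) := Fintype.ofFinite _
  choose P hP using htan
  let Φ := FrobPt (K := AlgebraicClosure F) (Fintype.card F)
  let Zl : ProjPlane F → Finset (ProjPlane (AlgebraicClosure F)) := fun ℓ => {P ℓ, Φ (P ℓ)}
  have hZl : ∀ ℓ, ∀ Q ∈ Zl ℓ, IsTangentAt f ℓ.rep Q := by
    intro ℓ Q hQ
    rcases Finset.mem_insert.mp hQ with rfl | hQ
    · exact hP ℓ
    · rw [Finset.mem_singleton.mp hQ]
      exact (hP ℓ).frobPt hf
  let Z := Finset.univ.biUnion Zl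
  have hZ : ∀ Q ∈ Z, ∃ ℓ : ProjPlane F, IsTangentAt f ℓ.rep Q := by
    intro Q hQ
    obtain ⟨ℓ, _, hℓ⟩ := Finset.mem_biUnion.mp hQ
    exact ⟨ℓ, hZl ℓ Q hℓ⟩
  have hbound : Z.card + (Z.filter fun Q => Φ Q = Q).card ≤ d * (d - 1 + Fintype.card F) := by
    refine card_add_card_le_mul hf'0 hf'h (isHomogeneous_frobForm hf'h _) hrel Z _
      (Finset.filter_subset _ _) ?_ ?_ ?_
    · intro Q hQ
      obtain ⟨ℓ, hℓ⟩ := hZ Q hQ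
      rw [hf', ← aeval_eq_eval_map]
      exact hℓ.1
    · intro Q hQ
      obtain ⟨ℓ, hℓ⟩ := hZ Q hQ
      exact hℓ.eval_frobForm_eq_zero hf
    · intro Q hQ
      rw [Finset.mem_filter] at hQ
      obtain ⟨ℓ, hℓ⟩ := hZ Q hQ.1
      obtain ⟨c, hc⟩ := (frobPt_eq_self_iff _ Q).mp hQ.2
      have hgrad : (fun i => aeval Q.rep (pderiv i f)) ≠ 0 := fun h => by
        obtain ⟨i, hi⟩ := hsmooth Q hℓ.1
        exact hi (congrFun h i)
      obtain ⟨w, hw, hwQ⟩ := exists_sum_eq_zero_not_smul hgrad Q.rep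
      have hw' : eval Q.rep (dirDeriv w f') = 0 := by
        rw [eval_dirDeriv, ← hw]
        simp_rw [hf', pderiv_map, ← aeval_eq_eval_map]
      exact ⟨w, hwQ, hw', eval_dirDeriv_frobForm_eq_zero hq hf'h
        (fun i => (congrFun hc i).symm) hw'⟩
  refine le_trans ?_ hbound
  rw [Finset.card_filter, Finset.card_eq_sum_ones, ← Finset.sum_add_distrib, Finset.sum_biUnion]
  · rw [Nat.card_eq_fintype_card, mul_comm, ← smul_eq_mul, ← Finset.card_univ,
      ← Finset.sum_const]
    refine Finset.sum_le_sum fun ℓ _ => ?_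
    by_cases h : Φ (P ℓ) = P ℓ
    · simp [Zl, h]
    · rw [Finset.sum_pair (Ne.symm h)]
      omega
  · intro ℓ _ ℓ' _ hne
    refine Finset.disjoint_left.mpr fun Q hQ hQ' => hne ?_
    exact (hZl ℓ Q hQ).unique (hZl ℓ' Q hQ')

/-- A smooth curve with finitely many flexes has no component in common with its Frobenius
form. -/
lemma isRelPrime_frobForm (hq : (Fintype.card F : AlgebraicClosure F) = 0)
    (h2 : (2 : AlgebraicClosure F) ≠ 0) (hf0 : f ≠ 0) (hf : f.IsHomogeneous d)
    (hsmooth : SmoothCurve f)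
    (hflex : {P : ProjPlane (AlgebraicClosure F) | IsFlex f P}.Finite) :
    IsRelPrime (map (algebraMap F (AlgebraicClosure F)) f)
      (frobForm (Fintype.card F) (map (algebraMap F (AlgebraicClosure F)) f)) := by
  set f' := map (algebraMap F (AlgebraicClosure F)) f with hf'
  have hf'h : f'.IsHomogeneous d := hf.map _
  have hf'0 : f' ≠ 0 := by
    rwa [hf', Ne, map_eq_zero_iff _ (map_injective _ (algebraMap F (AlgebraicClosure F)).injective)]
  by_contra hrel
  obtain ⟨m, k, hm, hk0, hk, hkf, hkg⟩ :=
    exists_isHomogeneous_dvd_of_not_isRelPrime hf'0 hf'h (isHomogeneous_frobForm hf'h _) hrel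
  refine ((infinite_zeros_of_isHomogeneous hm hk0 hk).sdiff
    (finite_frobPt_eq_self (Fintype.one_lt_card (α := F)))) (hflex.subset ?_)
  rintro P ⟨hkP, hPΦ⟩
  replace hkP : eval P.rep k = 0 := hkP
  have hfP : eval P.rep f' = 0 := by
    obtain ⟨l, hl⟩ := hkf
    rw [hl, map_mul, hkP, zero_mul]
  have hgP : eval P.rep (frobForm (Fintype.card F) f') = 0 := by
    obtain ⟨l, hl⟩ := hkg
    rw [hl, map_mul, hkP, zero_mul]
  have hcurve : OnCurve f P := (aeval_eq_eval_map _ _).trans hfP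
  have hgrad : (fun i => eval P.rep (pderiv i f')) ≠ 0 := fun h => by
    obtain ⟨i, hi⟩ := hsmooth P hcurve
    refine hi ?_
    rw [aeval_eq_eval_map, ← pderiv_map]
    exact congrFun h i
  refine ⟨hcurve, fun i => P.rep i ^ Fintype.card F, ?_, ?_, ?_⟩
  · rintro ⟨c, hc⟩
    exact hPΦ ((frobPt_eq_self_iff _ P).mpr ⟨c, hc.symm⟩)
  · simp_rw [aeval_eq_eval_map, ← pderiv_map]
    rw [← eval_frobForm, hgP]
  · rw [LinePoly, ← aeval_map_algebraMap (AlgebraicClosure F)]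
    refine X_pow_three_dvd_lineRestrict h2 hfP ?_
      (eval_dirDeriv_dirDeriv_eq_zero hq hgrad hkf hkg hkP)
    rw [eval_dirDeriv, ← eval_frobForm, hgP]

end Tangents

/-- **Theorem 1 (sharp Bertini for reflexive plane curves).** If `C` is a smooth plane
curve of degree `d ≤ q + 1` over `F_q` (with `q` a power of a prime `p > 2`) which is
reflexive, i.e. has only finitely many flex points, then some `F_q`-line meets `C`
transversely. -/
theorem sharp_bertini_reflexive
    (p r q d : ℕ) [Fact p.Prime] (hp : 2 < p) (hr : 1 ≤ r) (hq : q = p ^ r)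
    (F : Type*) [Field F] [Fintype F] [CharP F p] (hcard : Fintype.card F = q)
    (f : MvPolynomial (Fin 3) F) (hf0 : f ≠ 0) (hfd : f.IsHomogeneous d)
    (hdq : d ≤ q + 1)
    (hsmooth : SmoothCurve f)
    (hreflexive : {P : ProjPlane (AlgebraicClosure F) | IsFlex f P}.Finite) :
    ∃ a : Fin 3 → F, a ≠ 0 ∧ Transverse f a d := by
  subst hcard
  have hcardF : (Fintype.card F : AlgebraicClosure F) = 0 := by
    rw [← map_natCast (algebraMap F (AlgebraicClosure F)), Nat.cast_card_eq_zero, map_zero]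
  have h2 : (2 : AlgebraicClosure F) ≠ 0 := by
    have : CharP (AlgebraicClosure F) p := charP_of_injective_algebraMap
      (algebraMap F (AlgebraicClosure F)).injective p
    exact Ring.two_ne_zero (by rw [ringChar.eq _ p]; omega)
  by_contra! h
  have hle := two_mul_card_le_mul hcardF hf0 hfd hsmooth
    (isRelPrime_frobForm hcardF h2 hf0 hfd hsmooth hreflexive)
    fun ℓ => exists_isTangentAt_of_not_transverse hfd hsmooth ℓ.rep_nonzero (h _ ℓ.rep_nonzero)
  rw [Projectivization.card_of_finrank F (Fin 3 → F) (Module.finrank_fin_fun F),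
    Nat.card_eq_fintype_card, Finset.sum_range_succ, Finset.sum_range_succ,
    Finset.sum_range_one] at hle
  have hle' : d * (d - 1 + Fintype.card F) ≤
      (Fintype.card F + 1) * (Fintype.card F + Fintype.card F) :=
    Nat.mul_le_mul hdq (by omega)
  nlinarith

end
end

section
/- Let q = p^r with p > 2 prime and r ≥ 2, and let C be a smooth non-reflexive plane curve over F_q (i.e., C has infinitely many flex points) of degree p + 1 or 2p + 1. Then there exists an F_q-line L such that L intersects C transversely, i.e., L ∩ C consists of deg(C) distinct points over the algebraic closure of F_q. -/
open MvPolynomial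

noncomputable section

variable {F : Type*} [Field F]

/-- Scaling a point multiplies the value of a form of degree `d` by the `d`-th power. -/
lemma aeval_mul_of_isHomogeneous {R A σ : Type*} [CommRing R] [CommRing A] [Algebra R A] [Fintype σ]
    {f : MvPolynomial σ R} {d : ℕ} (hf : f.IsHomogeneous d) (v : σ → A) (t : A) :
    aeval (fun i => v i * t) f = aeval v f * t ^ d := by
  rw [aeval_def, aeval_def, eval₂_eq', eval₂_eq', Finset.sum_mul]
  refine Finset.sum_congr rfl fun m hm => ?_
  have hdeg : ∑ i, m i = d := by
    rw [← Finsupp.degree_eq_sum]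
    by_contra hne
    exact (mem_support_iff.1 hm) (hf.coeff_eq_zero hne)
  simp_rw [mul_pow, Finset.prod_mul_distrib, Finset.prod_pow_eq_pow_sum, hdeg, mul_assoc]

section CommonZeros

variable {K : Type*} [Field K]

/-- The ideal of polynomials vanishing at the origin of affine 3-space has height at least 3. -/
lemma three_le_height_ker_aeval_zero :
    3 ≤ (RingHom.ker (aeval (0 : Fin 3 → K) : MvPolynomial (Fin 3) K →ₐ[K] K)).height := by
  let φ₁ : MvPolynomial (Fin 3) K →ₐ[K] MvPolynomial (Fin 3) K := aeval ![0, X 1, X 2]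
  let φ₂ : MvPolynomial (Fin 3) K →ₐ[K] MvPolynomial (Fin 3) K := aeval ![0, 0, X 2]
  let φ₃ : MvPolynomial (Fin 3) K →ₐ[K] K := aeval (0 : Fin 3 → K)
  have h01 : (⊥ : Ideal (MvPolynomial (Fin 3) K)) < RingHom.ker φ₁ := by
    refine lt_of_le_of_ne bot_le fun h => ?_
    have : (X 0 : MvPolynomial (Fin 3) K) ∈ RingHom.ker φ₁ := by
      simp [RingHom.mem_ker, φ₁]
    rw [← h] at this
    exact X_ne_zero _ this
  have h12 : RingHom.ker φ₁ < RingHom.ker φ₂ := by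
    refine lt_of_le_of_ne ?_ fun h => ?_
    · have hc : φ₂ = φ₂.comp φ₁ := by
        ext i; fin_cases i <;> simp [φ₁, φ₂]
      intro x hx
      rw [RingHom.mem_ker] at hx ⊢
      rw [hc, AlgHom.comp_apply, hx, map_zero]
    · have : (X 1 : MvPolynomial (Fin 3) K) ∈ RingHom.ker φ₂ := by
        simp [RingHom.mem_ker, φ₂]
      rw [← h, RingHom.mem_ker] at this
      simp [φ₁] at this
  have h23 : RingHom.ker φ₂ < RingHom.ker φ₃ := by
    refine lt_of_le_of_ne ?_ fun h => ?_
    · have hc : φ₃ = φ₃.comp φ₂ := by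
        ext i; fin_cases i <;> simp [φ₂, φ₃]
      intro x hx
      rw [RingHom.mem_ker] at hx ⊢
      rw [hc, AlgHom.comp_apply, hx, map_zero]
    · have : (X 2 : MvPolynomial (Fin 3) K) ∈ RingHom.ker φ₃ := by
        simp [RingHom.mem_ker, φ₃]
      rw [← h, RingHom.mem_ker] at this
      simp [φ₂] at this
  have := RingHom.ker_isPrime φ₁
  have := RingHom.ker_isPrime φ₂
  have := RingHom.ker_isPrime φ₃
  have e1 := Ideal.height_add_one_le_of_lt_of_isPrime h01
  have e2 := Ideal.height_add_one_le_of_lt_of_isPrime h12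
  have e3 := Ideal.height_add_one_le_of_lt_of_isPrime h23
  calc (3 : ℕ∞) = 0 + 1 + 1 + 1 := by norm_num
    _ ≤ (RingHom.ker φ₁).height + 1 + 1 := by gcongr; exact le_trans (by simp) e1
    _ ≤ (RingHom.ker φ₂).height + 1 := by gcongr
    _ ≤ _ := e3

/-- A polynomial vanishing at every common zero of an ideal has a power in the ideal, for an ideal
whose only common zero is the origin. -/
lemma exists_pow_mem_of_zeros_subset [IsAlgClosed K] (I : Ideal (MvPolynomial (Fin 3) K))
    (hI : ∀ P : Fin 3 → K, (∀ g ∈ I, eval P g = 0) → P = 0) (u : MvPolynomial (Fin 3) K)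
    (hu : eval 0 u = 0) : ∃ n, u ^ n ∈ I := by
  have h : u ∈ vanishingIdeal K (zeroLocus K I) := by
    rw [mem_vanishingIdeal_iff]
    intro x hx
    rw [mem_zeroLocus_iff] at hx
    have := hI x (fun g hg => by simpa [aeval_eq_eval] using hx g hg)
    subst this
    simpa [aeval_eq_eval] using hu
  rw [vanishingIdeal_zeroLocus_eq_radical] at h
  exact h

/-- Two polynomials in three variables vanishing at the origin have another common zero. -/
lemma exists_ne_zero_common_zero [IsAlgClosed K] (g h : MvPolynomial (Fin 3) K)
    (hg : eval 0 g = 0) (hh : eval 0 h = 0) :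
    ∃ P : Fin 3 → K, P ≠ 0 ∧ eval P g = 0 ∧ eval P h = 0 := by
  by_contra! hno
  set m := RingHom.ker (aeval (0 : Fin 3 → K) : MvPolynomial (Fin 3) K →ₐ[K] K) with hm
  have hprime : m.IsPrime := RingHom.ker_isPrime _
  have hmem : ∀ u, u ∈ m ↔ eval 0 u = 0 := fun u => by
    simp [hm, RingHom.mem_ker]
  have hmin : m ∈ (Ideal.span {g, h}).minimalPrimes := by
    refine ⟨⟨hprime, ?_⟩, fun Q hQ _ u hu => ?_⟩
    · rw [Ideal.span_le]
      rintro x (rfl | rfl)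
      · exact (hmem _).2 hg
      · exact (hmem _).2 hh
    · obtain ⟨n, hn⟩ := exists_pow_mem_of_zeros_subset (Ideal.span {g, h}) (fun P hP => by
        by_contra hP0
        exact hno P hP0 (hP g (Ideal.subset_span (by simp)))
          (hP h (Ideal.subset_span (by simp)))) u ((hmem u).1 hu)
      exact hQ.1.mem_of_pow_mem n (hQ.2 hn)
  classical
  have h2 := Ideal.height_le_card_of_mem_minimalPrimes_span_finset (s := {g, h}) (p := m)
    (by simpa using hmin)
  have h3 := three_le_height_ker_aeval_zero (K := K)
  have h4 : (({g, h} : Finset (MvPolynomial (Fin 3) K)).card : ℕ∞) ≤ 2 := by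
    exact_mod_cast Finset.card_le_two
  have := (h3.trans h2).trans h4
  exact absurd this (by decide)

/-- A factor of a homogeneous polynomial that does not vanish at the origin is a unit. -/
lemma isUnit_of_mul_isHomogeneous {σ : Type*} [Fintype σ] {g h : MvPolynomial σ K} {d : ℕ}
    (hgh : (g * h).IsHomogeneous d) (h0 : g * h ≠ 0) (hg : eval 0 g ≠ 0) : IsUnit g := by
  let φ : MvPolynomial σ K →ₐ[K] Polynomial (MvPolynomial σ K) :=
    aeval fun i => Polynomial.C (X i) * Polynomial.X
  have hφ : φ (g * h) = Polynomial.C (g * h) * Polynomial.X ^ d := by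
    have hX : ∀ u : MvPolynomial σ K,
        aeval (fun i => (Polynomial.C (X i) : Polynomial (MvPolynomial σ K))) u =
          Polynomial.C u := by
      intro u
      induction u using MvPolynomial.induction_on with
      | C a => simp [Polynomial.algebraMap_apply, algebraMap_eq]
      | add p q hp hq => rw [map_add, hp, hq, map_add]
      | mul_X p i hp => rw [map_mul, hp, aeval_X, map_mul]
    rw [← hX]
    exact aeval_mul_of_isHomogeneous hgh _ _
  have hφ1 : ∀ u, (φ u).eval 1 = u := by
    intro u
    induction u using MvPolynomial.induction_on with
    | C a => simp [φ, Polynomial.algebraMap_apply, algebraMap_eq]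
    | add p q hp hq => rw [map_add, Polynomial.eval_add, hp, hq]
    | mul_X p i hp => rw [map_mul, Polynomial.eval_mul, hp]; simp [φ]
  have hφ0 : ∀ u, (φ u).coeff 0 = C (eval 0 u) := by
    intro u
    induction u using MvPolynomial.induction_on with
    | C a => simp [φ, Polynomial.algebraMap_apply, algebraMap_eq]
    | add p q hp hq => simp [hp, hq]
    | mul_X p i hp => rw [map_mul, Polynomial.mul_coeff_zero, hp]; simp [φ]
  have hne : φ g * φ h ≠ 0 := by
    rw [← map_mul, hφ]
    simpa using h0
  have hgne := left_ne_zero_of_mul hne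
  have hhne := right_ne_zero_of_mul hne
  have hdeg := Polynomial.natDegree_mul hgne hhne
  have htr := Polynomial.natTrailingDegree_mul hgne hhne
  rw [← map_mul, hφ] at hdeg htr
  rw [Polynomial.natDegree_C_mul_X_pow _ _ h0] at hdeg
  have ht : (Polynomial.C (g * h) * Polynomial.X ^ d).natTrailingDegree = d := by
    rw [Polynomial.C_mul_X_pow_eq_monomial, Polynomial.natTrailingDegree_monomial h0]
  have htg : (φ g).natTrailingDegree = 0 := by
    apply Polynomial.natTrailingDegree_eq_zero_of_constantCoeff_ne_zero
    simpa [hφ0] using hg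
  have hth := Polynomial.natTrailingDegree_le_natDegree (φ h)
  have hz : (φ g).natDegree = 0 := by omega
  rw [← hφ1 g, Polynomial.eq_C_of_natDegree_eq_zero hz, hφ0]
  simpa using hg

/-- A form whose zero locus is smooth is irreducible. -/
lemma irreducible_of_smooth [IsAlgClosed K] {f : MvPolynomial (Fin 3) K} {d : ℕ}
    (hf : f.IsHomogeneous d) (hd : d ≠ 0) (h0 : f ≠ 0)
    (hs : ∀ P : Fin 3 → K, P ≠ 0 → eval P f = 0 → ∃ i, eval P (pderiv i f) ≠ 0) :
    Irreducible f := by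
  refine ⟨fun hu => hd ?_, fun {g h} hgh => ?_⟩
  · obtain ⟨c, -, rfl⟩ := MvPolynomial.isUnit_iff_eq_C_of_isReduced.1 hu
    exact hf.inj_right (isHomogeneous_C _ c) h0
  by_contra! hno
  subst hgh
  have hg : eval 0 g = 0 := by
    by_contra hg
    exact hno.1 (isUnit_of_mul_isHomogeneous hf h0 hg)
  have hh : eval 0 h = 0 := by
    by_contra hh
    rw [mul_comm] at hf h0
    exact hno.2 (isUnit_of_mul_isHomogeneous hf h0 hh)
  obtain ⟨P, hP, hgP, hhP⟩ := exists_ne_zero_common_zero g h hg hh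
  obtain ⟨i, hi⟩ := hs P hP (by simp [hgP])
  apply hi
  simp [Derivation.leibniz, hgP, hhP]

/-- The ideal of the line through the origin spanned by `P`. -/
def coneIdeal (P : Fin 3 → K) : Ideal (MvPolynomial (Fin 3) K) :=
  RingHom.ker (aeval fun i => Polynomial.C (P i) * Polynomial.X :
    MvPolynomial (Fin 3) K →ₐ[K] Polynomial K)

instance (P : Fin 3 → K) : (coneIdeal P).IsPrime := RingHom.ker_isPrime _

lemma mem_coneIdeal {P : Fin 3 → K} {f : MvPolynomial (Fin 3) K} {d : ℕ}
    (hf : f.IsHomogeneous d) : f ∈ coneIdeal P ↔ eval P f = 0 := by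
  have hC : aeval (fun i => (Polynomial.C (P i) : Polynomial K)) f = Polynomial.C (eval P f) := by
    have := aeval_algebraMap_apply (Polynomial K) P f
    simpa [Polynomial.algebraMap_eq, aeval_eq_eval, Function.comp_def] using this
  rw [coneIdeal, RingHom.mem_ker, aeval_mul_of_isHomogeneous hf, hC]
  simp

/-- Primes containing two coprime forms inside the ideal of a line through the origin. -/
lemma coneIdeal_mem_minimalPrimes {f g : MvPolynomial (Fin 3) K} (hf : Irreducible f)
    (hfg : ¬ f ∣ g) {P : Fin 3 → K} (hP : P ≠ 0) (hfP : f ∈ coneIdeal P) (hgP : g ∈ coneIdeal P) :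
    coneIdeal P ∈ (Ideal.span {f, g}).minimalPrimes := by
  refine ⟨⟨inferInstance, ?_⟩, fun Q hQ hle => ?_⟩
  · rw [Ideal.span_le]
    rintro x (rfl | rfl) <;> assumption
  by_contra hlt
  have hQP : Q < coneIdeal P := lt_of_le_not_ge hle hlt
  have hfQ : f ∈ Q := hQ.2 (Ideal.subset_span (by simp))
  have hgQ : g ∈ Q := hQ.2 (Ideal.subset_span (by simp))
  have := hQ.1
  have hfp : (Ideal.span {f}).IsPrime :=
    (Ideal.span_singleton_prime hf.ne_zero).2 hf.prime
  have h0f : (⊥ : Ideal (MvPolynomial (Fin 3) K)) < Ideal.span {f} := by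
    rw [bot_lt_iff_ne_bot, Ne, Ideal.span_singleton_eq_bot]
    exact hf.ne_zero
  have hfQ' : Ideal.span {f} < Q := by
    refine lt_of_le_of_ne ((Ideal.span_singleton_le_iff_mem _).2 hfQ) fun h => hfg ?_
    rw [← h, Ideal.mem_span_singleton] at hgQ
    exact hgQ
  let m := RingHom.ker (aeval (0 : Fin 3 → K) : MvPolynomial (Fin 3) K →ₐ[K] K)
  have hm : m.IsPrime := RingHom.ker_isPrime _
  have hPm : coneIdeal P < m := by
    refine lt_of_le_of_ne (fun x hx => ?_) fun h => hP ?_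
    · have hx' : aeval (fun i => Polynomial.C (P i) * Polynomial.X : Fin 3 → Polynomial K) x = 0 :=
        hx
      have h2 := congrArg (Polynomial.aeval (0 : K)) hx'
      rw [comp_aeval_apply] at h2
      have h3 : (fun i => Polynomial.aeval (0 : K) (Polynomial.C (P i) * Polynomial.X)) =
        (0 : Fin 3 → K) := by
        funext i; simp
      rw [h3, map_zero] at h2
      exact h2
    · funext i
      have : (X i : MvPolynomial (Fin 3) K) ∈ m := by simp [m, RingHom.mem_ker]
      rw [← h, mem_coneIdeal (isHomogeneous_X K i)] at this
      simpa using this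
  have e1 := Ideal.height_add_one_le_of_lt_of_isPrime h0f
  have e2 := Ideal.height_add_one_le_of_lt_of_isPrime hfQ'
  have e3 := Ideal.height_add_one_le_of_lt_of_isPrime hQP
  have e4 := Ideal.height_add_one_le_of_lt_of_isPrime hPm
  have hdim : (m.height : WithBot ℕ∞) ≤ 3 := by
    refine Ideal.height_le_ringKrullDim_of_isPrime.trans ?_
    rw [MvPolynomial.ringKrullDim_of_isNoetherianRing]
    simp
  have hdim' : m.height ≤ 3 := WithBot.coe_le_coe.1 hdim
  have : (4 : ℕ∞) ≤ m.height := calc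
    (4 : ℕ∞) = 0 + 1 + 1 + 1 + 1 := by norm_num
    _ ≤ (Ideal.span {f}).height + 1 + 1 + 1 := by gcongr; exact le_trans (by simp) e1
    _ ≤ Q.height + 1 + 1 := by gcongr
    _ ≤ (coneIdeal P).height + 1 := by gcongr
    _ ≤ _ := e4
  exact absurd (this.trans hdim') (by decide)

/-- An irreducible form divides every form sharing infinitely many projective zeros with it. -/
lemma dvd_of_infinite_common_zeros {f g : MvPolynomial (Fin 3) K} {d e : ℕ} (hf : Irreducible f)
    (hfd : f.IsHomogeneous d) (hge : g.IsHomogeneous e)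
    (hinf : {P : Projectivization K (Fin 3 → K) | eval P.rep f = 0 ∧ eval P.rep g = 0}.Infinite) :
    f ∣ g := by
  by_contra hfg
  refine hinf (Set.Finite.of_finite_image (f := fun P => coneIdeal P.rep)
    ((Ideal.finite_minimalPrimes_of_isNoetherianRing _ (Ideal.span {f, g})).subset ?_) ?_)
  · rintro _ ⟨P, ⟨hfP, hgP⟩, rfl⟩
    exact coneIdeal_mem_minimalPrimes hf hfg P.rep_nonzero ((mem_coneIdeal hfd).2 hfP)
      ((mem_coneIdeal hge).2 hgP)
  · intro P _ Q _ hPQ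
    have key : ∀ i j, P.rep i * Q.rep j = P.rep j * Q.rep i := by
      intro i j
      have hh : (C (P.rep i) * X j - C (P.rep j) * X i : MvPolynomial (Fin 3) K).IsHomogeneous 1 :=
        (isHomogeneous_C_mul_X _ _).sub (isHomogeneous_C_mul_X _ _)
      have h1 : (C (P.rep i) * X j - C (P.rep j) * X i : MvPolynomial (Fin 3) K) ∈
          coneIdeal P.rep := by
        rw [mem_coneIdeal hh]
        simp [mul_comm]
      have h2 : _ ∈ coneIdeal Q.rep := (show coneIdeal P.rep = coneIdeal Q.rep from hPQ) ▸ h1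
      rw [mem_coneIdeal hh] at h2
      simpa [sub_eq_zero] using h2
    obtain ⟨i, hi⟩ : ∃ i, Q.rep i ≠ 0 := by
      by_contra! h
      exact Q.rep_nonzero (funext h)
    rw [← P.mk_rep, ← Q.mk_rep, Projectivization.mk_eq_mk_iff']
    refine ⟨P.rep i / Q.rep i, funext fun j => ?_⟩
    simp only [Pi.smul_apply, smul_eq_mul]
    rw [div_mul_eq_mul_div, key i j, mul_div_assoc, div_self hi, mul_one]

end CommonZeros

lemma pderiv_pderiv_comm {R σ : Type*} [CommRing R] (i j : σ) (f : MvPolynomial σ R) :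
    pderiv i (pderiv j f) = pderiv j (pderiv i f) := by
  classical
  induction f using MvPolynomial.induction_on with
  | C a => simp
  | add p q hp hq => simp only [map_add, hp, hq]
  | mul_X p k hp =>
    have hX : ∀ i j, pderiv i (pderiv j (X k : MvPolynomial σ R)) = 0 := fun i j => by
      rw [pderiv_X, Pi.single_apply]
      split_ifs <;> simp
    simp only [pderiv_mul, map_add, hX, hp]
    ring

section Unmixed

/-- If `a, b` and `x, y` are coprime pairs in a factorial domain and `b` is a nonzerodivisor
modulo `(x, y)`, then `(x, y)` contains a nonzerodivisor modulo `(a, b)` up to annihilation. -/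
lemma mem_span_pair_of_mul_mem {S : Type*} [CommRing S] [IsDomain S] [DecompositionMonoid S]
    {a b x y u : S} (hb : b ≠ 0) (hx : x ≠ 0) (hab : IsRelPrime a b) (hxy : IsRelPrime x y)
    (hreg : ∀ t, t * b ∈ Ideal.span {x, y} → t ∈ Ideal.span {x, y})
    (hxu : x * u ∈ Ideal.span {a, b}) (hyu : y * u ∈ Ideal.span {a, b}) :
    u ∈ Ideal.span {a, b} := by
  obtain ⟨α, β, h1⟩ := Ideal.mem_span_pair.1 hxu
  obtain ⟨γ, δ, h2⟩ := Ideal.mem_span_pair.1 hyu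
  have h3 : (y * α - x * γ) * a = (x * δ - y * β) * b := by linear_combination y * h1 - x * h2
  obtain ⟨t, ht⟩ : b ∣ y * α - x * γ :=
    hab.symm.dvd_of_dvd_mul_right ⟨x * δ - y * β, by rw [h3, mul_comm]⟩
  have ht' : x * δ - y * β = t * a := by
    apply mul_right_cancel₀ hb
    rw [← h3, ht]; ring
  obtain ⟨s, r, hsr⟩ := Ideal.mem_span_pair.1 (hreg t (Ideal.mem_span_pair.2
    ⟨-γ, α, by rw [mul_comm t, ← ht]; ring⟩))
  obtain ⟨c, hc⟩ : x ∣ α - r * b := hxy.dvd_of_dvd_mul_left (y := y)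
    ⟨γ + s * b, by rw [← hsr] at ht; linear_combination ht⟩
  obtain ⟨c', hc'⟩ : x ∣ β + r * a := hxy.dvd_of_dvd_mul_left (y := y)
    ⟨δ - s * a, by rw [← hsr] at ht'; linear_combination - ht'⟩
  refine Ideal.mem_span_pair.2 ⟨c, c', mul_left_cancel₀ hx ?_⟩
  linear_combination h1 - a * hc - b * hc'

lemma mem_of_pow_mul_mem {S : Type*} [CommRing S] {I : Ideal S} {x y : S}
    (h : ∀ u, x * u ∈ I → y * u ∈ I → u ∈ I) {m n : ℕ} {u : S}
    (hx : x ^ m * u ∈ I) (hy : y ^ n * u ∈ I) : u ∈ I := by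
  induction m generalizing u n with
  | zero => simpa using hx
  | succ m ihm =>
    refine ihm (n := n) ?_ hy
    have hx' : x * (x ^ m * u) ∈ I := by rwa [← mul_assoc, ← pow_succ']
    have hy' : y ^ n * (x ^ m * u) ∈ I := by
      rw [mul_left_comm]; exact I.mul_mem_left _ hy
    generalize x ^ m * u = v at hx' hy'
    clear hx hy ihm
    induction n with
    | zero => simpa using hy'
    | succ n ihn =>
      refine ihn (h _ ?_ ?_)
      · rw [mul_left_comm]; exact I.mul_mem_left _ hx'
      · rwa [← mul_assoc, ← pow_succ']

variable {K : Type*} [Field K]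

lemma coneIdeal_eq_span (r s : K) :
    coneIdeal ![1, r, s] = Ideal.span {X 1 - C r * X 0, X 2 - C s * X 0} := by
  set J : Ideal (MvPolynomial (Fin 3) K) :=
    Ideal.span {X 1 - C r * X 0, X 2 - C s * X 0} with hJ
  refine le_antisymm (fun u hu => ?_) ?_
  · have hu' : aeval (fun i => Polynomial.C (![1, r, s] i) * Polynomial.X :
        Fin 3 → Polynomial K) u = 0 := hu
    let ι : Polynomial K →ₐ[K] MvPolynomial (Fin 3) K := Polynomial.aeval (X 0)
    have hcomp : (Ideal.Quotient.mkₐ K J).comp (ι.comp (aeval (fun i =>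
        Polynomial.C (![1, r, s] i) * Polynomial.X : Fin 3 → Polynomial K))) =
        Ideal.Quotient.mkₐ K J := by
      ext i
      simp only [AlgHom.comp_apply, aeval_X, Ideal.Quotient.mkₐ_eq_mk, ι]
      rw [eq_comm, Ideal.Quotient.eq]
      fin_cases i
      · simp
      · exact Ideal.subset_span (by simp [algebraMap_eq])
      · exact Ideal.subset_span (by simp [algebraMap_eq])
    have := DFunLike.congr_fun hcomp u
    rw [AlgHom.comp_apply, AlgHom.comp_apply, hu', map_zero, map_zero] at this
    exact Ideal.Quotient.eq_zero_iff_mem.1 this.symm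
  · rw [hJ, Ideal.span_le]
    rintro x (rfl | rfl)
    · exact (mem_coneIdeal ((isHomogeneous_X K _).sub (isHomogeneous_C_mul_X _ _))).2 (by simp)
    · exact (mem_coneIdeal ((isHomogeneous_X K _).sub (isHomogeneous_C_mul_X _ _))).2 (by simp)

lemma irreducible_X_sub_C_mul_X (r : K) {i j : Fin 3} (hij : i ≠ j) :
    Irreducible (X i - C r * X j : MvPolynomial (Fin 3) K) := by
  classical
  have hcoeff : coeff (Finsupp.single i 1) (X i - C r * X j : MvPolynomial (Fin 3) K) = 1 := by
    rw [coeff_sub, coeff_C_mul, coeff_X, coeff_single_X]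
    simp [hij.symm]
  have hne : (X i - C r * X j : MvPolynomial (Fin 3) K) ≠ 0 := by
    intro h
    rw [h, coeff_zero] at hcoeff
    exact zero_ne_one hcoeff
  refine irreducible_of_totalDegree_eq_one
    (((isHomogeneous_X K i).sub (isHomogeneous_C_mul_X r j)).totalDegree hne) fun x hx => ?_
  have := hx (Finsupp.single i 1)
  rw [hcoeff] at this
  exact isUnit_of_dvd_one this

/-- The ideal of two coprime forms has no embedded component at the origin. -/
lemma mem_span_pair_of_zeros [IsAlgClosed K] {a b u : MvPolynomial (Fin 3) K} {d : ℕ}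
    (hb : b.IsHomogeneous d) (hb0 : b ≠ 0) (hab : IsRelPrime a b)
    (I : Ideal (MvPolynomial (Fin 3) K))
    (hI : ∀ P : Fin 3 → K, (∀ g ∈ I, eval P g = 0) → P = 0)
    (hIu : ∀ g ∈ I, g * u ∈ Ideal.span {a, b}) : u ∈ Ideal.span {a, b} := by
  obtain ⟨R, hR⟩ : ∃ R : Fin 3 → K, eval R (X 0 * b) ≠ 0 := by
    by_contra! h
    exact mul_ne_zero (X_ne_zero 0) hb0 (MvPolynomial.funext fun x => by simpa using h x)
  rw [map_mul, eval_X] at hR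
  have hR0 := left_ne_zero_of_mul hR
  have hbR := right_ne_zero_of_mul hR
  set r := R 1 / R 0
  set s := R 2 / R 0
  have hbrs : eval ![1, r, s] b ≠ 0 := by
    intro h0
    apply hbR
    have := aeval_mul_of_isHomogeneous hb ![1, r, s] (R 0)
    rw [aeval_eq_eval, aeval_eq_eval] at this
    rw [h0, zero_mul] at this
    rw [← this]
    congr 2
    funext i
    fin_cases i <;> simp [r, s, div_mul_cancel₀ _ hR0]
  have hreg : ∀ t, t * b ∈ Ideal.span {X 1 - C r * X 0, X 2 - C s * X 0} →
      t ∈ Ideal.span {X 1 - C r * X 0, X 2 - C s * X 0} := by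
    rw [← coneIdeal_eq_span]
    intro t ht
    exact (Ideal.IsPrime.mem_or_mem inferInstance ht).resolve_right
      fun h => hbrs ((mem_coneIdeal hb).1 h)
  have hxy : IsRelPrime (X 1 - C r * X 0) (X 2 - C s * X 0 : MvPolynomial (Fin 3) K) := by
    rw [(irreducible_X_sub_C_mul_X r (by decide)).isRelPrime_iff_not_dvd]
    rintro ⟨c, hc⟩
    have := congrArg (eval (![0, 0, 1] : Fin 3 → K)) hc
    simp at this
  obtain ⟨m, hm⟩ := exists_pow_mem_of_zeros_subset I hI (X 1 - C r * X 0) (by simp)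
  obtain ⟨n, hn⟩ := exists_pow_mem_of_zeros_subset I hI (X 2 - C s * X 0) (by simp)
  exact mem_of_pow_mul_mem (fun u => mem_span_pair_of_mul_mem hb0
    (irreducible_X_sub_C_mul_X r (by decide)).ne_zero hab hxy hreg) (hIu _ hm) (hIu _ hn)

/-- A form in the ideal of two forms of larger degree vanishes. -/
lemma eq_zero_of_mem_span_pair {σ : Type*} {a b u : MvPolynomial σ K} {k l n : ℕ}
    (ha : a.IsHomogeneous k) (hb : b.IsHomogeneous l) (hu : u.IsHomogeneous n)
    (hk : n < k) (hl : n < l) (h : u ∈ Ideal.span {a, b}) : u = 0 := by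
  classical
  have key : ∀ (c e : MvPolynomial σ K) (k : ℕ), e.IsHomogeneous k → n < k →
      ∀ m : σ →₀ ℕ, m.degree = n → coeff m (c * e) = 0 := by
    intro c e k he hk m hm
    rw [coeff_mul]
    refine Finset.sum_eq_zero fun x hx => ?_
    rw [he.coeff_eq_zero, mul_zero]
    rw [Finset.HasAntidiagonal.mem_antidiagonal] at hx
    rw [← hx, map_add] at hm
    omega
  obtain ⟨α, β, rfl⟩ := Ideal.mem_span_pair.1 h
  ext m
  rw [coeff_zero]
  by_cases hm : m.degree = n
  · rw [coeff_add, key _ _ _ ha hk m hm, key _ _ _ hb hl m hm, add_zero]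
  · exact hu.coeff_eq_zero hm

/-- A nonzero form is not divisible by a form of larger degree. -/
lemma eq_zero_of_dvd_of_lt {σ : Type*} {b u : MvPolynomial σ K} {l n : ℕ}
    (hb : b.IsHomogeneous l) (hu : u.IsHomogeneous n) (hl : n < l) (h : b ∣ u) : u = 0 :=
  eq_zero_of_mem_span_pair hb hb hu hl hl (by simpa [Ideal.mem_span_singleton] using h)

/-- If the curvature of a smooth plane curve vanishes identically, in characteristic not 2, then so
do all the second partial derivatives of its equation. -/
lemma pderiv_pderiv_eq_zero [IsAlgClosed K] (h2 : (2 : K) ≠ 0) {f : MvPolynomial (Fin 3) K} {d : ℕ}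
    (hf : f.IsHomogeneous d) (hd : 2 ≤ d) (h0 : f ≠ 0)
    (hs : ∀ P : Fin 3 → K, P ≠ 0 → eval P f = 0 → ∃ i, eval P (pderiv i f) ≠ 0)
    (hcurv : ∀ i j, f ∣ pderiv i (pderiv i f) * pderiv j f ^ 2
      - 2 * (pderiv i (pderiv j f) * (pderiv i f * pderiv j f))
      + pderiv j (pderiv j f) * pderiv i f ^ 2) (i j : Fin 3) :
    pderiv i (pderiv j f) = 0 := by
  have hirr : Irreducible f := irreducible_of_smooth hf (by omega) h0 hs
  have hdeg1 : ∀ i, (pderiv i f).IsHomogeneous (d - 1) := fun i => hf.pderiv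
  have hdeg2 : ∀ i j, (pderiv i (pderiv j f)).IsHomogeneous (d - 2) := fun i j => (hdeg1 j).pderiv
  have hdiag : ∀ i, pderiv i (pderiv i f) = 0 := by
    intro i
    by_cases hi : pderiv i f = 0
    · simp [hi]
    have hrel : IsRelPrime (pderiv i f) f := by
      rw [isRelPrime_comm, hirr.isRelPrime_iff_not_dvd]
      exact fun h => hi (eq_zero_of_dvd_of_lt hf (hdeg1 i) (by omega) h)
    refine eq_zero_of_mem_span_pair (hdeg1 i) hf (hdeg2 i i) (by omega) (by omega)
      (mem_span_pair_of_zeros hf h0 hrel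
      (Ideal.span {pderiv i f, f} ⊔ Ideal.span (Set.range fun j => pderiv j f ^ 2)) ?_ ?_)
    · intro P hP
      by_contra hP0
      obtain ⟨j, hj⟩ := hs P hP0 (hP f (Ideal.mem_sup_left (Ideal.subset_span (by simp))))
      have := hP (pderiv j f ^ 2) (Ideal.mem_sup_right (Ideal.subset_span ⟨j, rfl⟩))
      rw [map_pow] at this
      exact hj (pow_eq_zero_iff two_ne_zero |>.1 this)
    · intro g hg
      have hle : Ideal.span {pderiv i f, f} ⊔ Ideal.span (Set.range fun j => pderiv j f ^ 2) ≤
          (Ideal.span {pderiv i f, f}).colon {pderiv i (pderiv i f)} := by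
        refine sup_le (fun x hx => ?_) (Ideal.span_le.2 ?_)
        · rw [Submodule.mem_colon_singleton]
          exact Ideal.mul_mem_right _ _ hx
        · rintro _ ⟨j, rfl⟩
          obtain ⟨c, hc⟩ := hcurv i j
          refine Submodule.mem_colon_singleton.2 (Ideal.mem_span_pair.2
            ⟨2 * (pderiv i (pderiv j f) * pderiv j f) - pderiv j (pderiv j f) * pderiv i f, c, ?_⟩)
          rw [smul_eq_mul]
          linear_combination - hc
      exact Submodule.mem_colon_singleton.1 (hle hg)
  obtain ⟨c, hc⟩ := hcurv i j
  rw [hdiag, hdiag, zero_mul, zero_mul, zero_sub, add_zero] at hc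
  have hC2 : (2 : MvPolynomial (Fin 3) K) = C 2 := (map_ofNat C 2).symm
  have hdvd : f ∣ pderiv i (pderiv j f) * (pderiv i f * pderiv j f) := by
    refine ⟨C (-(2 : K)⁻¹) * c, ?_⟩
    have hu : (C (2 : K)⁻¹ : MvPolynomial (Fin 3) K) * 2 = 1 := by
      rw [hC2, ← C_mul, inv_mul_cancel₀ h2, C_1]
    rw [C_neg]
    linear_combination - (C (2 : K)⁻¹) * hc - pderiv i (pderiv j f) * (pderiv i f * pderiv j f) * hu
  rcases hirr.prime.dvd_or_dvd hdvd with h | h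
  · exact eq_zero_of_dvd_of_lt hf (hdeg2 i j) (by omega) h
  rcases hirr.prime.dvd_or_dvd h with h | h
  · rw [pderiv_pderiv_comm, eq_zero_of_dvd_of_lt hf (hdeg1 i) (by omega) h, map_zero]
  · rw [eq_zero_of_dvd_of_lt hf (hdeg1 j) (by omega) h, map_zero]

end Unmixed

section SmoothPoints

lemma exists_rep_mk_eq {K : Type*} [Field K] {v : Fin 3 → K} (hv : v ≠ 0) :
    ∃ c : K, c ≠ 0 ∧ (Projectivization.mk K v hv).rep = fun i => v i * c := by
  obtain ⟨c, hc⟩ := Projectivization.exists_smul_eq_mk_rep K v hv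
  refine ⟨c, c.ne_zero, ?_⟩
  rw [← hc]
  funext i
  simp [Units.smul_def, mul_comm]

lemma SmoothCurve.exists_aeval_pderiv_ne_zero {f : MvPolynomial (Fin 3) F} {d : ℕ}
    (hf : f.IsHomogeneous d) (hs : SmoothCurve f) {P : Fin 3 → AlgebraicClosure F} (hP : P ≠ 0)
    (hfP : aeval P f = 0) : ∃ i, aeval P (pderiv i f) ≠ 0 := by
  obtain ⟨c, hc0, hc⟩ := exists_rep_mk_eq hP
  obtain ⟨i, hi⟩ := hs (Projectivization.mk _ P hP) (by
    rw [OnCurve, hc, aeval_mul_of_isHomogeneous hf, hfP, zero_mul])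
  refine ⟨i, fun h0 => hi ?_⟩
  rw [hc, aeval_mul_of_isHomogeneous (hf.pderiv (i := i)), h0, zero_mul]

lemma SmoothCurve.exists_eval_pderiv_map_ne_zero {f : MvPolynomial (Fin 3) F} {d : ℕ}
    (hf : f.IsHomogeneous d) (hs : SmoothCurve f) {P : Fin 3 → AlgebraicClosure F} (hP : P ≠ 0)
    (hfP : eval P (map (algebraMap F (AlgebraicClosure F)) f) = 0) :
    ∃ i, eval P (pderiv i (map (algebraMap F (AlgebraicClosure F)) f)) ≠ 0 := by
  rw [eval_map, ← aeval_def] at hfP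
  obtain ⟨k, hk⟩ := hs.exists_aeval_pderiv_ne_zero hf hP hfP
  exact ⟨k, by rwa [pderiv_map, eval_map, ← aeval_def]⟩

lemma SmoothCurve.irreducible_map {f : MvPolynomial (Fin 3) F} {d : ℕ} (hf0 : f ≠ 0)
    (hf : f.IsHomogeneous d) (hd : d ≠ 0) (hs : SmoothCurve f) :
    Irreducible (map (algebraMap F (AlgebraicClosure F)) f) :=
  irreducible_of_smooth (hf.map _) hd
    (fun h => hf0 (map_injective _ (algebraMap F (AlgebraicClosure F)).injective
      (by rw [h, map_zero])))
    fun _ => hs.exists_eval_pderiv_map_ne_zero hf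

end SmoothPoints

section Flexes

lemma derivative_linePoly (f : MvPolynomial (Fin 3) F) (v w : Fin 3 → AlgebraicClosure F) :
    Polynomial.derivative (LinePoly f v w) =
      ∑ i, LinePoly (pderiv i f) v w * Polynomial.C (w i) := by
  classical
  unfold LinePoly
  induction f using MvPolynomial.induction_on with
  | C a => simp [Polynomial.algebraMap_apply]
  | add p q hp hq => simp only [map_add, hp, hq, add_mul, Finset.sum_add_distrib]
  | mul_X p k hp =>
    simp only [map_mul, Polynomial.derivative_mul, hp, pderiv_mul, map_add, aeval_X, add_mul,
      Finset.sum_add_distrib, pderiv_X]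
    congr 1
    · rw [Finset.sum_mul]
      exact Finset.sum_congr rfl fun i _ => by ring
    · rw [Finset.sum_eq_single k]
      · simp
      · intro i _ hi
        simp [Pi.single_eq_of_ne hi.symm]
      · simp

lemma eval_linePoly (f : MvPolynomial (Fin 3) F) (v w : Fin 3 → AlgebraicClosure F)
    (t : AlgebraicClosure F) : (LinePoly f v w).eval t = aeval (v + t • w) f := by
  have := comp_aeval_apply (fun i => Polynomial.C (v i) + Polynomial.X * Polynomial.C (w i))
    ((Polynomial.aeval t).restrictScalars F) f
  simp only [AlgHom.restrictScalars_apply, Polynomial.coe_aeval_eq_eval] at this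
  rw [LinePoly, this]
  congr 2
  funext i
  simp only [Polynomial.eval_add, Polynomial.eval_C, Polynomial.eval_mul, Polynomial.eval_X,
    Pi.add_apply, Pi.smul_apply, smul_eq_mul]

lemma eval_zero_linePoly (f : MvPolynomial (Fin 3) F) (v w : Fin 3 → AlgebraicClosure F) :
    (LinePoly f v w).eval 0 = aeval v f := by
  rw [eval_linePoly, zero_smul, add_zero]

/-- Two independent vectors span the plane `g = 0` containing them. -/
lemma exists_smul_add_smul_eq {K : Type*} [Field K] {g v w : Fin 3 → K} (hg : g ≠ 0)
    (hgv : ∑ i, g i * v i = 0) (hgw : ∑ i, g i * w i = 0) (hv0 : v ≠ 0)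
    (hvw : ¬ ∃ c : K, w = c • v) {e : Fin 3 → K} (hge : ∑ i, g i * e i = 0) :
    ∃ α β : K, α • v + β • w = e := by
  rw [← Submodule.mem_span_pair]
  let ℓ : (Fin 3 → K) →ₗ[K] K := Fintype.linearCombination K g
  have hℓ : ∀ x, ℓ x = ∑ i, g i * x i := fun x => by
    simp [ℓ, Fintype.linearCombination_apply, mul_comm]
  have hli : LinearIndependent K ![v, w] := by
    rw [LinearIndependent.pair_iff' hv0]
    exact fun c hc => hvw ⟨c, hc.symm⟩
  have hfin : Module.finrank K (Submodule.span K {v, w}) = 2 := by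
    have hrange : Set.range ![v, w] = {v, w} := by
      simp only [Matrix.range_cons, Matrix.range_empty, Set.union_empty, Set.singleton_union]
    rw [← hrange, finrank_span_eq_card hli, Fintype.card_fin]
  have hle : Submodule.span K {v, w} ≤ LinearMap.ker ℓ := by
    rw [Submodule.span_le]
    rintro x (rfl | rfl)
    · simpa [hℓ] using hgv
    · simpa [hℓ] using hgw
  have hker : Module.finrank K (LinearMap.ker ℓ) ≤ 2 := by
    have hlt : LinearMap.ker ℓ < ⊤ := by
      rw [lt_top_iff_ne_top, Ne, LinearMap.ker_eq_top]
      intro h0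
      apply hg
      funext i
      have := hℓ (Pi.single i 1)
      rw [h0] at this
      simpa [Pi.single_apply] using this.symm
    have := Submodule.finrank_lt_finrank_of_lt hlt
    rw [finrank_top, Module.finrank_fin_fun] at this
    omega
  have heq := Submodule.eq_of_le_of_finrank_le hle (by rw [hfin]; exact hker)
  rw [heq, LinearMap.mem_ker, hℓ]
  exact hge

/-- A symmetric bilinear form killing `v` and isotropic at a second vector `w` of the plane `g = 0`
is isotropic on this plane. -/
lemma isotropic_of_radical {K : Type*} [Field K] {H : Fin 3 → Fin 3 → K} {g v w : Fin 3 → K}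
    (hsymm : ∀ i j, H i j = H j i) (hv : ∀ i, ∑ j, H i j * v j = 0)
    (hw : ∑ i, ∑ j, H i j * w i * w j = 0) (hg : g ≠ 0) (hgv : ∑ i, g i * v i = 0)
    (hgw : ∑ i, g i * w i = 0) (hv0 : v ≠ 0) (hvw : ¬ ∃ c : K, w = c • v)
    {e : Fin 3 → K} (hge : ∑ i, g i * e i = 0) : ∑ i, ∑ j, H i j * e i * e j = 0 := by
  obtain ⟨α, β, rfl⟩ := exists_smul_add_smul_eq hg hgv hgw hv0 hvw hge
  have h0 := hv 0
  have h1 := hv 1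
  have h2 := hv 2
  have s1 := hsymm 0 1
  have s2 := hsymm 0 2
  have s3 := hsymm 1 2
  simp only [Fin.sum_univ_three, Pi.add_apply, Pi.smul_apply, smul_eq_mul] at *
  rw [← s1, ← s2, ← s3] at *
  linear_combination β ^ 2 * hw + (α ^ 2 * v 0 + 2 * α * β * w 0) * h0 +
    (α ^ 2 * v 1 + 2 * α * β * w 1) * h1 + (α ^ 2 * v 2 + 2 * α * β * w 2) * h2

/-- The curvature of a plane curve of degree congruent to 1 vanishes at its flexes. -/
lemma curvature_eq_zero_of_isFlex {f : MvPolynomial (Fin 3) F} {d : ℕ} (hf : f.IsHomogeneous d)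
    (hd : (d : F) = 1) (hs : SmoothCurve f) {P : ProjPlane (AlgebraicClosure F)}
    (hP : IsFlex f P) (i j : Fin 3) :
    aeval P.rep (pderiv i (pderiv i f) * pderiv j f ^ 2
      - 2 * (pderiv i (pderiv j f) * (pderiv i f * pderiv j f))
      + pderiv j (pderiv j f) * pderiv i f ^ 2) = 0 := by
  classical
  obtain ⟨hfP, w, hw, hgw, hX⟩ := hP
  set v := P.rep with hv
  set H : Fin 3 → Fin 3 → AlgebraicClosure F := fun i j => aeval v (pderiv i (pderiv j f)) with hH
  set g : Fin 3 → AlgebraicClosure F := fun i => aeval v (pderiv i f) with hg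
  have hsymm : ∀ i j, H i j = H j i := fun i j => by
    simp only [hH]; rw [pderiv_pderiv_comm]
  have hEuler : ∑ i, X i * pderiv i f = f := by
    rw [hf.sum_X_mul_pderiv, nsmul_eq_mul, ← map_natCast C, hd, C_1, one_mul]
  have hHv : ∀ i, ∑ j, H i j * v j = 0 := fun i => by
    have := congrArg (pderiv i) hEuler
    simp only [map_sum, pderiv_mul, Finset.sum_add_distrib, pderiv_X] at this
    rw [Finset.sum_eq_single i] at this
    · have h2 := congrArg (aeval v) this
      simpa [hH, mul_comm] using h2
    · intro k _ hk
      simp [Pi.single_eq_of_ne hk]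
    · simp
  have hgv : ∑ i, g i * v i = 0 := by
    have h2 := congrArg (aeval v) hEuler
    rw [show aeval v f = 0 from hfP] at h2
    simpa [hg, mul_comm] using h2
  have hg0 : g ≠ 0 := by
    obtain ⟨k, hk⟩ := hs P hfP
    exact fun h => hk (congrFun h k)
  have hww : ∑ i, ∑ j, H i j * w i * w j = 0 := by
    obtain ⟨c, hc⟩ := hX
    have h1 : (Polynomial.derivative (Polynomial.derivative (LinePoly f v w))).eval 0 = 0 := by
      rw [hc]
      simp
    simp only [derivative_linePoly, Polynomial.derivative_sum, Polynomial.derivative_mul,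
      Polynomial.derivative_C, mul_zero, add_zero, Polynomial.eval_finsetSum,
      Polynomial.eval_mul, Polynomial.eval_C, eval_zero_linePoly] at h1
    rw [← h1, Finset.sum_comm]
    refine Finset.sum_congr rfl fun j _ => ?_
    rw [Finset.sum_mul]
  have hge : ∑ k, g k * (Pi.single i (g j) - Pi.single j (g i) : Fin 3 → AlgebraicClosure F) k
      = 0 := by
    simp [Pi.single_apply, mul_sub, Finset.sum_sub_distrib, mul_comm]
  have key := isotropic_of_radical hsymm hHv hww hg0 hgv hgw P.rep_nonzero hw hge
  have hs' := hsymm i j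
  simp only [Pi.sub_apply, Pi.single_apply, mul_sub, sub_mul, Finset.sum_sub_distrib, mul_ite,
    ite_mul, mul_zero, zero_mul, Finset.sum_ite_eq', Finset.mem_univ, if_true] at key
  simp only [map_add, map_sub, map_mul, map_pow, map_ofNat]
  change H i i * g j ^ 2 - 2 * (H i j * (g i * g j)) + H j j * g i ^ 2 = 0
  linear_combination key - (g i * g j) * hs'

/-- The second partial derivatives of the equation of a smooth plane curve of degree congruent
to 1 with infinitely many flexes vanish. -/
lemma pderiv_pderiv_eq_zero_of_flexes (h2 : (2 : F) ≠ 0) {f : MvPolynomial (Fin 3) F} {d : ℕ}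
    (hf0 : f ≠ 0) (hf : f.IsHomogeneous d) (hd2 : 2 ≤ d) (hd : (d : F) = 1) (hs : SmoothCurve f)
    (hinf : {P : ProjPlane (AlgebraicClosure F) | IsFlex f P}.Infinite) (i j : Fin 3) :
    pderiv i (pderiv j f) = 0 := by
  set φ := algebraMap F (AlgebraicClosure F)
  have hinj : Function.Injective (map φ : MvPolynomial (Fin 3) F → _) :=
    map_injective φ φ.injective
  have hev : ∀ P (u : MvPolynomial (Fin 3) F), eval P (map φ u) = aeval P u := fun P u => by
    rw [eval_map, aeval_def]
  have hf0' : map φ f ≠ 0 := fun h => hf0 (hinj (by rw [h, map_zero]))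
  apply hinj
  rw [map_zero, ← pderiv_map, ← pderiv_map]
  refine pderiv_pderiv_eq_zero ?_ (hf.map φ) hd2 hf0'
    (fun _ => hs.exists_eval_pderiv_map_ne_zero hf) (fun i j => ?_) i j
  · rw [← map_ofNat φ 2]
    simpa using h2
  refine dvd_of_infinite_common_zeros (hs.irreducible_map hf0 hf (by omega))
    (hf.map φ) (e := d - 1 - 1 + (d - 1) * 2) ?_ (hinf.mono fun P hP => ⟨?_, ?_⟩)
  · have hd1 : ∀ k, (pderiv k (map φ f)).IsHomogeneous (d - 1) := fun k => (hf.map φ).pderiv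
    refine (((hd1 i).pderiv.mul ((hd1 j).pow 2)).sub ?_).add ((hd1 j).pderiv.mul ((hd1 i).pow 2))
    rw [show (2 : MvPolynomial (Fin 3) (AlgebraicClosure F)) = C 2 from (map_ofNat C 2).symm,
      mul_two (d - 1)]
    exact ((hd1 j).pderiv.mul ((hd1 i).mul (hd1 j))).C_mul 2
  · rw [hev]; exact hP.1
  · have := curvature_eq_zero_of_isFlex hf hd hs hP i j
    rw [← hev] at this
    simpa only [map_add, map_sub, map_mul, map_pow, map_ofNat, pderiv_map] using this

end Flexes

section Transversality

lemma exists_sum_mul_eq_zero_not_smul {K : Type*} [Field K] (g v : Fin 3 → K) :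
    ∃ w : Fin 3 → K, ∑ i, g i * w i = 0 ∧ ¬ ∃ c : K, w = c • v := by
  by_contra! h
  let ℓ : (Fin 3 → K) →ₗ[K] K := Fintype.linearCombination K g
  have hle : LinearMap.ker ℓ ≤ Submodule.span K {v} := by
    intro x hx
    obtain ⟨c, hc⟩ := h x (by
      simpa [ℓ, Fintype.linearCombination_apply, mul_comm] using LinearMap.mem_ker.1 hx)
    exact Submodule.mem_span_singleton.2 ⟨c, hc.symm⟩
  have h1 := (Submodule.finrank_mono hle).trans (finrank_span_le_card {v})
  have h2 := ℓ.finrank_range_add_finrank_ker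
  have h3 := (LinearMap.range ℓ).finrank_le
  rw [Module.finrank_self] at h3
  rw [Module.finrank_fin_fun] at h2
  simp at h1
  omega

/-- A linear form vanishing at two independent vectors of the plane `a = 0` is a multiple of `a`. -/
lemma exists_eq_mul_of_sum_mul_eq_zero {K : Type*} [Field K] {a g v w : Fin 3 → K} (ha : a ≠ 0)
    (hav : ∑ i, a i * v i = 0) (haw : ∑ i, a i * w i = 0) (hv0 : v ≠ 0)
    (hvw : ¬ ∃ c : K, w = c • v) (hgv : ∑ i, g i * v i = 0) (hgw : ∑ i, g i * w i = 0) :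
    ∃ c : K, ∀ i, g i = c * a i := by
  obtain ⟨k, hk⟩ := Function.ne_iff.1 ha
  rw [Pi.zero_apply] at hk
  refine ⟨g k / a k, fun i => ?_⟩
  obtain ⟨α, β, he⟩ := exists_smul_add_smul_eq ha hav haw hv0 hvw
    (e := Pi.single i (a k) - Pi.single k (a i))
    (by simp [Pi.single_apply, mul_sub, Finset.sum_sub_distrib, mul_comm])
  have hge : ∑ j, g j * (Pi.single i (a k) - Pi.single k (a i) : Fin 3 → K) j = 0 := by
    rw [← he]
    simp only [Pi.add_apply, Pi.smul_apply, smul_eq_mul, mul_add, Finset.sum_add_distrib]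
    simp only [mul_left_comm (g _), ← Finset.mul_sum, hgv, hgw, mul_zero, add_zero]
  simp only [Pi.sub_apply, Pi.single_apply, mul_sub, Finset.sum_sub_distrib, mul_ite, mul_zero,
    Finset.sum_ite_eq', Finset.mem_univ, if_true] at hge
  field_simp
  linear_combination hge

lemma natDegree_linePoly_le_and_coeff {f : MvPolynomial (Fin 3) F} {d : ℕ} (hf : f.IsHomogeneous d)
    (v w : Fin 3 → AlgebraicClosure F) :
    (LinePoly f v w).natDegree ≤ d ∧ (LinePoly f v w).coeff d = aeval w f := by
  have hlin : ∀ i, (Polynomial.C (v i) + Polynomial.X * Polynomial.C (w i)).natDegree ≤ 1 :=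
    fun i => by compute_degree
  have hc1 : ∀ i, (Polynomial.C (v i) + Polynomial.X * Polynomial.C (w i)).coeff 1 = w i :=
    fun i => by simp [Polynomial.coeff_C]
  have hdeg : ∀ m ∈ f.support, ∑ i, m i = d := fun m hm => by
    rw [← Finsupp.degree_eq_sum]
    by_contra hne
    exact (mem_support_iff.1 hm) (hf.coeff_eq_zero hne)
  have hpow : ∀ (i : Fin 3) (n : ℕ),
      ((Polynomial.C (v i) + Polynomial.X * Polynomial.C (w i)) ^ n).natDegree ≤ n := fun i n =>
    (Polynomial.natDegree_pow_le_of_le n (hlin i)).trans (by simp)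
  have hprod : ∀ m ∈ f.support,
      (∏ i, (Polynomial.C (v i) + Polynomial.X * Polynomial.C (w i)) ^ m i).natDegree ≤ d := by
    intro m hm
    rw [← hdeg m hm]
    exact (Polynomial.natDegree_prod_le _ _).trans (Finset.sum_le_sum fun i _ => hpow i _)
  rw [LinePoly, aeval_def, aeval_def, eval₂_eq', eval₂_eq']
  constructor
  · refine Polynomial.natDegree_sum_le_of_forall_le _ _ fun m hm => ?_
    rw [Polynomial.algebraMap_apply]
    exact (Polynomial.natDegree_C_mul_le _ _).trans (hprod m hm)
  · rw [Polynomial.finsetSum_coeff]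
    refine Finset.sum_congr rfl fun m hm => ?_
    rw [Polynomial.algebraMap_apply, Polynomial.coeff_C_mul]
    congr 1
    have hcp : ∀ n : ℕ, ∀ i, ((Polynomial.C (v i) + Polynomial.X * Polynomial.C (w i)) ^ n).coeff n
        = w i ^ n := fun n i => by
      have := Polynomial.coeff_pow_of_natDegree_le (m := n) (hlin i)
      rw [mul_one] at this
      rw [this, hc1]
    have h3 := hdeg m hm
    rw [Fin.sum_univ_three] at h3
    rw [Fin.prod_univ_three, Fin.prod_univ_three, ← h3,
      Polynomial.coeff_mul_add_eq_of_natDegree_le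
        (Polynomial.natDegree_mul_le.trans (add_le_add (hpow 0 _) (hpow 1 _))) (hpow 2 _),
      Polynomial.coeff_mul_add_eq_of_natDegree_le (hpow 0 _) (hpow 1 _), hcp, hcp, hcp]

/-- A line which is nowhere tangent to a smooth curve meets it transversely. -/
lemma transverse_of_forall_not_tangent {f : MvPolynomial (Fin 3) F} {d : ℕ}
    (hf : f.IsHomogeneous d) (hd : d ≠ 0) (hs : SmoothCurve f) {a : Fin 3 → F} (ha : a ≠ 0)
    (h : ∀ P : Fin 3 → AlgebraicClosure F, P ≠ 0 → aeval P f = 0 → ∀ c ≠ 0,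
      ¬ ∀ i, aeval P (pderiv i f) = c * algebraMap F (AlgebraicClosure F) (a i)) :
    Transverse f a d := by
  classical
  set b : Fin 3 → AlgebraicClosure F := fun i => algebraMap F (AlgebraicClosure F) (a i) with hb
  have hb0 : b ≠ 0 := by
    obtain ⟨k, hk⟩ := Function.ne_iff.1 ha
    exact fun h0 => hk ((map_eq_zero _).1 (congrFun h0 k))
  have hEuler : ∀ P : Fin 3 → AlgebraicClosure F, aeval P f = 0 →
      ∑ i, aeval P (pderiv i f) * P i = 0 := fun P hP => by
    have := congrArg (aeval P) hf.sum_X_mul_pderiv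
    rw [map_nsmul, hP, smul_zero] at this
    simpa [mul_comm] using this
  have hcontact : ∀ P w : Fin 3 → AlgebraicClosure F, ∑ i, b i * P i = 0 → ∑ i, b i * w i = 0 →
      P ≠ 0 → (¬ ∃ c : AlgebraicClosure F, w = c • P) → aeval P f = 0 →
      ∑ i, aeval P (pderiv i f) * w i ≠ 0 := by
    intro P w hbP hbw hP hPw hfP hgw
    obtain ⟨c, hc⟩ := exists_eq_mul_of_sum_mul_eq_zero hb0 hbP hbw hP hPw (hEuler P hfP) hgw
    obtain ⟨i, hi⟩ := hs.exists_aeval_pderiv_ne_zero hf hP hfP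
    exact h P hP hfP c (fun h0 => hi (by rw [hc i, h0, zero_mul])) hc
  have hderiv : ∀ (u w : Fin 3 → AlgebraicClosure F) (t : AlgebraicClosure F),
      (Polynomial.derivative (LinePoly f u w)).eval t =
        ∑ i, aeval (u + t • w) (pderiv i f) * w i := fun u w t => by
    simp [derivative_linePoly, Polynomial.eval_finsetSum, eval_linePoly]
  obtain ⟨w, hbw, hfw⟩ : ∃ w : Fin 3 → AlgebraicClosure F, ∑ i, b i * w i = 0 ∧ aeval w f ≠ 0 := by
    by_contra! hzero
    obtain ⟨P, hbP, hP⟩ := exists_sum_mul_eq_zero_not_smul b 0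
    have hP0 : P ≠ 0 := fun h0 => hP ⟨0, by simp [h0]⟩
    obtain ⟨w, hbw, hw⟩ := exists_sum_mul_eq_zero_not_smul b P
    refine hcontact P w hbP hbw hP0 hw (hzero P hbP) ?_
    have hline : LinePoly f P w = 0 := Polynomial.funext fun t => by
      rw [eval_linePoly, Polynomial.eval_zero]
      apply hzero
      simp only [Pi.add_apply, Pi.smul_apply, smul_eq_mul, mul_add, Finset.sum_add_distrib]
      simp only [mul_left_comm (b _), ← Finset.mul_sum, hbP, hbw, mul_zero, add_zero]
    have := hderiv P w 0
    simpa [hline] using this.symm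
  have hw0 : w ≠ 0 := by
    rintro rfl
    have := aeval_mul_of_isHomogeneous hf (0 : Fin 3 → AlgebraicClosure F) 0
    rw [zero_pow hd, mul_zero] at this
    exact hfw (by simpa using this)
  obtain ⟨u, hbu, hu⟩ := exists_sum_mul_eq_zero_not_smul b w
  have hline : ∀ t : AlgebraicClosure F, ∑ i, b i * (u + t • w) i = 0 := fun t => by
    simp only [Pi.add_apply, Pi.smul_apply, smul_eq_mul, mul_add, Finset.sum_add_distrib]
    simp only [mul_left_comm (b _), ← Finset.mul_sum, hbu, hbw, mul_zero, add_zero]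
  have hne : ∀ t : AlgebraicClosure F, u + t • w ≠ 0 := fun t h0 =>
    hu ⟨-t, by rw [neg_smul]; exact eq_neg_of_add_eq_zero_left h0⟩
  have hnsmul : ∀ t : AlgebraicClosure F, ¬ ∃ c : AlgebraicClosure F, w = c • (u + t • w) := by
    rintro t ⟨c, hc⟩
    have hc0 : c ≠ 0 := by
      rintro rfl
      exact hw0 (by simpa using hc)
    refine hu ⟨c⁻¹ - t, ?_⟩
    rw [sub_smul, eq_sub_iff_add_eq]
    exact (inv_smul_eq_iff₀ hc0).2 hc |>.symm
  obtain ⟨hdeg, hcoeff⟩ := natDegree_linePoly_le_and_coeff hf u w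
  set φ := LinePoly f u w with hφ
  have hφd : φ.natDegree = d :=
    le_antisymm hdeg (Polynomial.le_natDegree_of_ne_zero (by rwa [hcoeff]))
  have hφ0 : φ ≠ 0 := fun h0 => hfw (by rw [← hcoeff, h0, Polynomial.coeff_zero])
  have hroot : ∀ t, t ∈ φ.roots.toFinset ↔ aeval (u + t • w) f = 0 := fun t => by
    rw [Multiset.mem_toFinset, Polynomial.mem_roots hφ0, Polynomial.IsRoot, hφ, eval_linePoly]
  have hnodup : φ.roots.Nodup := by
    rw [Multiset.nodup_iff_count_le_one]
    intro t
    rw [Polynomial.count_roots]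
    by_contra! hmult
    obtain ⟨h1, h2⟩ := (Polynomial.one_lt_rootMultiplicity_iff_isRoot hφ0).1 hmult
    rw [Polynomial.IsRoot, hφ, eval_linePoly] at h1
    rw [Polynomial.IsRoot, hφ, hderiv] at h2
    exact hcontact _ w (hline t) hbw (hne t) (hnsmul t) h1 h2
  have hcardroots : φ.roots.toFinset.card = d := by
    rw [Multiset.toFinset_card_of_nodup hnodup, ← hφd]
    exact (IsAlgClosed.splits φ).natDegree_eq_card_roots.symm
  have himage : {P : ProjPlane (AlgebraicClosure F) | OnCurve f P ∧ OnLine a P} =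
      (fun t => Projectivization.mk (AlgebraicClosure F) (u + t • w) (hne t)) ''
        (φ.roots.toFinset : Set (AlgebraicClosure F)) := by
    ext P
    simp only [Set.mem_ofPred_eq, Set.mem_image, Finset.mem_coe, hroot]
    constructor
    · rintro ⟨hfP, hbP⟩
      obtain ⟨β, α, hαβ⟩ := exists_smul_add_smul_eq hb0 hbw hbu hw0 hu hbP
      have hα : α ≠ 0 := by
        rintro rfl
        rw [zero_smul, add_zero] at hαβ
        have hβ : β ≠ 0 := by
          rintro rfl
          exact P.rep_nonzero (by rw [← hαβ, zero_smul])
        have h1 := aeval_mul_of_isHomogeneous hf w β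
        rw [show (fun i => w i * β) = P.rep from by rw [← hαβ]; funext i; simp [mul_comm],
          show aeval P.rep f = 0 from hfP] at h1
        exact mul_ne_zero hfw (pow_ne_zero d hβ) h1.symm
      have hP : (fun i => (u + (β / α) • w) i * α) = P.rep := by
        rw [← hαβ]
        funext i
        simp only [Pi.add_apply, Pi.smul_apply, smul_eq_mul]
        field_simp
        ring
      refine ⟨β / α, ?_, ?_⟩
      · have h1 := aeval_mul_of_isHomogeneous hf (u + (β / α) • w) α
        rw [hP, show aeval P.rep f = 0 from hfP] at h1
        exact (mul_eq_zero.1 h1.symm).resolve_right (pow_ne_zero d hα)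
      · rw [← P.mk_rep]
        refine (Projectivization.mk_eq_mk_iff' _ _ _ _ _).2 ⟨α⁻¹, ?_⟩
        rw [← hP]
        funext i
        simp only [Pi.smul_apply, smul_eq_mul]
        field_simp
    · rintro ⟨t, ht, rfl⟩
      obtain ⟨c, hc0, hc⟩ := exists_rep_mk_eq (hne t)
      refine ⟨?_, ?_⟩
      · rw [OnCurve, hc, aeval_mul_of_isHomogeneous hf, ht, zero_mul]
      · rw [OnLine, hc]
        simp only [← mul_assoc, ← Finset.sum_mul]
        rw [hline t, zero_mul]
  rw [Transverse, himage, Set.InjOn.ncard_image, Set.ncard_coe_finset, hcardroots]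
  intro s _ t _ hst
  obtain ⟨c, hc⟩ := (Projectivization.mk_eq_mk_iff' _ _ _ _ _).1 hst
  have hc1 : c = 1 := by
    by_contra hc1
    refine hu ⟨(c * t - s) / (1 - c), ?_⟩
    have hc1' : 1 - c ≠ 0 := sub_ne_zero.2 (Ne.symm hc1)
    funext i
    have hci := congrFun hc i
    simp only [Pi.add_apply, Pi.smul_apply, smul_eq_mul] at hci ⊢
    field_simp
    linear_combination -hci
  rw [hc1, one_smul] at hc
  exact (smul_left_injective _ hw0 (add_left_cancel hc)).symm

end Transversality

section PthRoots

variable {σ : Type*} {p : ℕ} [Fact p.Prime] [CharP F p] [PerfectRing F p]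

/-- Over a perfect field, a form with vanishing partial derivatives is the `p`-th power of a form. -/
lemma exists_pow_char_eq_of_pderiv_eq_zero {g : MvPolynomial σ F} {n : ℕ}
    (hg : g.IsHomogeneous (p * n)) (h : ∀ i, pderiv i g = 0) :
    ∃ G : MvPolynomial σ F, G.IsHomogeneous n ∧ G ^ p = g := by
  classical
  have hp : p.Prime := Fact.out
  have hdvd : ∀ m ∈ g.support, ∀ i, p ∣ m i := by
    intro m hm i
    by_contra hpm
    have hmi : m i ≠ 0 := fun h0 => hpm (h0 ▸ dvd_zero p)
    have hadd : m - Finsupp.single i 1 + Finsupp.single i 1 = m :=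
      tsub_add_cancel_of_le (Finsupp.single_le_iff.2 (Nat.one_le_iff_ne_zero.2 hmi))
    have := coeff_pderiv (i := i) g (m - Finsupp.single i 1)
    rw [h i, coeff_zero, hadd] at this
    have hmul : coeff m g * ((m i : ℕ) : F) = 0 := by
      rw [this]
      congr 1
      have := DFunLike.congr_fun hadd i
      rw [← this]
      simp
    rcases mul_eq_zero.1 hmul with h0 | h0
    · exact mem_support_iff.1 hm h0
    · exact hpm ((CharP.cast_eq_zero_iff F p _).1 h0)
  have hroot : ∀ m ∈ g.support, p • m.mapRange (· / p) (Nat.zero_div p) = m := by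
    intro m hm
    ext i
    simpa using Nat.mul_div_cancel' (hdvd m hm i)
  refine ⟨∑ m ∈ g.support, monomial (m.mapRange (· / p) (Nat.zero_div p))
    ((frobeniusEquiv F p).symm (coeff m g)), IsHomogeneous.sum _ _ _ fun m hm => ?_, ?_⟩
  · apply isHomogeneous_monomial
    have hdeg : m.degree = p * n := by
      by_contra hne
      exact mem_support_iff.1 hm (hg.coeff_eq_zero hne)
    rw [← hroot m hm, map_nsmul, smul_eq_mul] at hdeg
    exact Nat.eq_of_mul_eq_mul_left hp.pos hdeg
  · rw [sum_pow_char]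
    conv_rhs => rw [g.as_sum]
    refine Finset.sum_congr rfl fun m hm => ?_
    rw [monomial_pow, hroot m hm, frobeniusEquiv_symm_pow_p]

end PthRoots

section Dimension

/-- The dimension of the space of ternary forms of degree `n`. -/
lemma finrank_homogeneousSubmodule_fin_three (K : Type*) [Field K] (n : ℕ) :
    Module.finrank K (homogeneousSubmodule (Fin 3) K n) = (n + 2).choose 2 := by
  classical
  have hset : {d : Fin 3 →₀ ℕ | d.degree = n} =
      ((Finset.finsuppAntidiag Finset.univ n : Finset (Fin 3 →₀ ℕ)) : Set (Fin 3 →₀ ℕ)) := by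
    ext d
    simp [Finset.mem_finsuppAntidiag, Finsupp.degree_eq_sum]
  rw [homogeneousSubmodule_eq_finsupp_supported, hset,
    (AddMonoidAlgebra.supportedEquivFinsupp _).finrank_eq, Module.finrank_finsupp_self]
  simp only [Finset.coe_sort_coe, Fintype.card_coe, Finset.card_finsuppAntidiag_nat_eq_choose,
    Finset.card_univ, Fintype.card_fin]
  rw [show 3 + n - 1 = n + 2 by omega, Nat.choose_symm_add]

end Dimension

section CountingForms

instance (K : Type*) [Field K] (n : ℕ) : Module.Finite K (homogeneousSubmodule (Fin 3) K n) :=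
  Module.Finite.iff_fg.2 (homogeneousSubmodule_fg _ _ n)

/-- A linear map from `S` to `N` hits a subspace `W` of `N` at a nonzero vector of `S`
as soon as the dimensions of `S` and `W` exceed that of `N` in total. -/
lemma exists_ne_zero_mem_of_finrank_lt {K U V : Type*} [Field K] [AddCommGroup U] [Module K U]
    [AddCommGroup V] [Module K V] (A : U →ₗ[K] V) {S : Submodule K U} {N W : Submodule K V}
    [Module.Finite K S] [Module.Finite K N] (hA : S.map A ≤ N) (hW : W ≤ N)
    (h : Module.finrank K N < Module.finrank K S + Module.finrank K W) :
    ∃ x ∈ S, x ≠ 0 ∧ A x ∈ W := by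
  by_contra! hno
  have hinj : Function.Injective (A.domRestrict S) := by
    rw [← LinearMap.ker_eq_bot, LinearMap.ker_eq_bot']
    intro x hx
    by_contra hx0
    refine hno x x.2 (fun h => hx0 (Subtype.ext h)) ?_
    rw [LinearMap.domRestrict_apply] at hx
    rw [hx]
    exact W.zero_mem
  have hmap : Module.finrank K (S.map A) = Module.finrank K S := by
    rw [← LinearMap.range_domRestrict]
    exact LinearMap.finrank_range_of_inj hinj
  have : Module.Finite K W := Submodule.finiteDimensional_of_le hW
  have hinf : S.map A ⊓ W = ⊥ := by
    rw [Submodule.eq_bot_iff]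
    rintro _ ⟨⟨x, hx, rfl⟩, hxW⟩
    by_contra hx0
    exact hno x hx (fun h => hx0 (by rw [h, map_zero])) hxW
  have hsum := Submodule.finrank_sup_add_finrank_inf_eq (S.map A) W
  have hle := Submodule.finrank_mono (sup_le hA hW)
  rw [hinf, finrank_bot, hmap] at hsum
  omega

variable {K : Type*} [Field K]

/-- The multiples of `g` by forms of degree `m`. -/
def formMultiples (g : MvPolynomial (Fin 3) K) (m : ℕ) : Submodule K (MvPolynomial (Fin 3) K) :=
  (homogeneousSubmodule (Fin 3) K m).map (LinearMap.mulLeft K g)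

lemma mem_formMultiples {g u : MvPolynomial (Fin 3) K} {m : ℕ} :
    u ∈ formMultiples g m ↔ ∃ t : MvPolynomial (Fin 3) K, t.IsHomogeneous m ∧ g * t = u := by
  simp [formMultiples, mem_homogeneousSubmodule]

instance (g : MvPolynomial (Fin 3) K) (m : ℕ) : Module.Finite K (formMultiples g m) := by
  unfold formMultiples
  infer_instance

lemma formMultiples_le {g : MvPolynomial (Fin 3) K} {l m n : ℕ} (hg : g.IsHomogeneous l)
    (hn : l + m = n) : formMultiples g m ≤ homogeneousSubmodule (Fin 3) K n := by
  intro u hu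
  obtain ⟨t, ht, rfl⟩ := mem_formMultiples.1 hu
  exact hn ▸ hg.mul ht

lemma finrank_formMultiples {g : MvPolynomial (Fin 3) K} (hg : g ≠ 0) (m : ℕ) :
    Module.finrank K (formMultiples g m) = (m + 2).choose 2 := by
  rw [formMultiples, ← (Submodule.equivMapOfInjective (LinearMap.mulLeft K g)
    (mul_right_injective₀ hg) _).finrank_eq, finrank_homogeneousSubmodule_fin_three]

lemma exists_isHomogeneous_mul_eq {σ : Type*} {g u : MvPolynomial σ K} {l m : ℕ}
    (hg : g.IsHomogeneous l) (hu : u.IsHomogeneous (l + m)) (h : g ∣ u) :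
    ∃ t : MvPolynomial σ K, t.IsHomogeneous m ∧ g * t = u := by
  classical
  obtain ⟨t, rfl⟩ := h
  let := gradedAlgebra (σ := σ) (R := K)
  refine ⟨DirectSum.decompose (homogeneousSubmodule σ K) t m,
    (mem_homogeneousSubmodule _ _).1 (SetLike.coe_mem _), ?_⟩
  rw [← DirectSum.coe_decompose_mul_add_of_left_mem (homogeneousSubmodule σ K) hg]
  exact DirectSum.decompose_of_mem_same _ hu

/-- A lower bound for the dimension of a homogeneous part of the ideal of an irreducible form `f`
and a polynomial `h` not divisible by `f`. -/
lemma le_finrank_formMultiples_sup {f h : MvPolynomial (Fin 3) K} {j k m : ℕ}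
    (hf : Irreducible f) (hfd : f.IsHomogeneous k) (hfh : ¬ f ∣ h) :
    (j + 2).choose 2 + (k + m + 2).choose 2 ≤
      Module.finrank K (formMultiples f j ⊔ formMultiples h (k + m) :
        Submodule K (MvPolynomial (Fin 3) K)) + (m + 2).choose 2 := by
  have hh0 : h ≠ 0 := fun h0 => hfh (h0 ▸ dvd_zero f)
  have hsum := Submodule.finrank_sup_add_finrank_inf_eq (formMultiples f j)
    (formMultiples h (k + m))
  rw [finrank_formMultiples hf.ne_zero, finrank_formMultiples hh0] at hsum
  rw [← hsum, ← finrank_formMultiples (mul_ne_zero hh0 hf.ne_zero) m]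
  refine Nat.add_le_add_left (Submodule.finrank_mono ?_) _
  rintro _ ⟨hu, hv⟩
  obtain ⟨s, -, rfl⟩ := mem_formMultiples.1 hu
  obtain ⟨t, ht, hst⟩ := mem_formMultiples.1 hv
  have hft : f ∣ t := (hf.prime.dvd_or_dvd (hst ▸ dvd_mul_right f s)).resolve_left hfh
  obtain ⟨w, hw, rfl⟩ := exists_isHomogeneous_mul_eq hfd ht hft
  exact mem_formMultiples.2 ⟨w, hw, by rw [← hst, mul_assoc]⟩

/-- Substituting forms of degree `k` into forms of degree `e`. -/
lemma exists_form_aeval_mem {G : Fin 3 → MvPolynomial (Fin 3) K} {k e : ℕ}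
    (hG : ∀ i, (G i).IsHomogeneous k) {W : Submodule K (MvPolynomial (Fin 3) K)}
    (hW : W ≤ homogeneousSubmodule (Fin 3) K (k * e))
    (h : (k * e + 2).choose 2 < (e + 2).choose 2 + Module.finrank K W) :
    ∃ Φ : MvPolynomial (Fin 3) K, Φ.IsHomogeneous e ∧ Φ ≠ 0 ∧ aeval G Φ ∈ W := by
  refine exists_ne_zero_mem_of_finrank_lt (S := homogeneousSubmodule (Fin 3) K e)
    (aeval G).toLinearMap ?_ hW ?_
  · rintro _ ⟨Φ, hΦ, rfl⟩
    exact IsHomogeneous.aeval hΦ G hG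
  · simpa only [finrank_homogeneousSubmodule_fin_three] using h

end CountingForms

section TangentLines

lemma aeval_algebraMap_comp {σ : Type*} (A : Type*) [CommRing A] [Algebra F A] (R : σ → F)
    (u : MvPolynomial σ F) :
    aeval (fun i => algebraMap F A (R i)) u = algebraMap F A (eval R u) := by
  rw [← aeval_eq_eval]
  exact aeval_algebraMap_apply A R u

lemma SmoothCurve.irreducible {f : MvPolynomial (Fin 3) F} {d : ℕ} (hf0 : f ≠ 0)
    (hf : f.IsHomogeneous d) (hd : d ≠ 0) (hs : SmoothCurve f) : Irreducible f := by
  have hmap := hs.irreducible_map hf0 hf hd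
  have hunit : ∀ u : MvPolynomial (Fin 3) F,
      IsUnit (map (algebraMap F (AlgebraicClosure F)) u) → eval 0 u ≠ 0 := by
    intro u hu h0
    have h1 := hu.map (eval (0 : Fin 3 → AlgebraicClosure F))
    have h2 := aeval_algebraMap_comp (AlgebraicClosure F) (0 : Fin 3 → F) u
    simp only [Pi.zero_apply, map_zero, h0] at h2
    rw [eval_map, ← aeval_def, Pi.zero_def, h2] at h1
    exact not_isUnit_zero h1
  refine ⟨fun hu => hmap.not_isUnit (hu.map _), fun g h hgh => ?_⟩
  subst hgh
  rw [map_mul] at hmap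
  rcases hmap.isUnit_or_isUnit rfl with hg | hh
  · exact Or.inl (isUnit_of_mul_isHomogeneous hf hf0 (hunit g hg))
  · rw [mul_comm] at hf hf0
    exact Or.inr (isUnit_of_mul_isHomogeneous hf hf0 (hunit h hh))

lemma aeval_add_mul_of_isHomogeneous_one {A σ : Type*} [CommRing A] [Algebra F A]
    {g : MvPolynomial σ F} (hg : g.IsHomogeneous 1) (x y : σ → A) (c : A) :
    aeval (fun i => x i + c * y i) g = aeval x g + c * aeval y g := by
  have hmem : g ∈ Submodule.span F (Set.range X) := by
    rw [← homogeneousSubmodule_one_eq_span_X]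
    exact hg
  clear hg
  induction hmem using Submodule.span_induction with
  | mem u hu =>
    obtain ⟨i, rfl⟩ := hu
    simp
  | zero => simp
  | add u v _ _ hu hv =>
    simp only [map_add, hu, hv]
    ring
  | smul r u _ hu => simp only [map_smul, hu, smul_add, mul_smul_comm]

variable {p : ℕ} [Fact p.Prime] [CharP F p]

/-- If the partial derivatives of `f` are the `p`-th powers of the components of `G` and no multiple
of `b` is a value of `G` on the curve, then the line with coefficients `b i ^ p` is transverse. -/
lemma exists_transverse_of_forall_aeval_ne {f : MvPolynomial (Fin 3) F} {d : ℕ}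
    (hf : f.IsHomogeneous d) (hd : d ≠ 0) (hs : SmoothCurve f)
    {G : Fin 3 → MvPolynomial (Fin 3) F} (hG : ∀ i, G i ^ p = pderiv i f)
    {b : Fin 3 → F} (hb : b ≠ 0)
    (h : ∀ P : Fin 3 → AlgebraicClosure F, P ≠ 0 → aeval P f = 0 → ∀ c ≠ 0,
      ¬ ∀ i, aeval P (G i) = c * algebraMap F (AlgebraicClosure F) (b i)) :
    ∃ a : Fin 3 → F, a ≠ 0 ∧ Transverse f a d := by
  have hp : p ≠ 0 := (Fact.out : p.Prime).ne_zero
  have : CharP (AlgebraicClosure F) p := charP_of_injective_algebraMap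
    (algebraMap F (AlgebraicClosure F)).injective p
  refine ⟨fun i => b i ^ p, fun h0 => hb ?_,
    transverse_of_forall_not_tangent hf hd hs (fun h0 => hb ?_) fun P hP hfP c hc hgrad => ?_⟩
  · exact funext fun i => pow_eq_zero_iff hp |>.1 (congrFun h0 i)
  · exact funext fun i => pow_eq_zero_iff hp |>.1 (congrFun h0 i)
  · obtain ⟨c', rfl⟩ := IsAlgClosed.exists_pow_nat_eq c (Nat.pos_of_ne_zero hp)
    refine h P hP hfP c' (fun h0 => hc (by rw [h0, zero_pow hp])) fun i => ?_
    have := hgrad i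
    rw [← hG, map_pow, map_pow, ← mul_pow] at this
    exact frobenius_inj (AlgebraicClosure F) p this

/-- A curve whose gradient consists of `p`-th powers of linear forms has a transverse line. -/
lemma exists_transverse_of_linear {f : MvPolynomial (Fin 3) F} {d : ℕ} [Fintype F] (hf0 : f ≠ 0)
    (hf : f.IsHomogeneous d) (hd : d ≠ 0) (hdq : d ≤ Fintype.card F) (hs : SmoothCurve f)
    {G : Fin 3 → MvPolynomial (Fin 3) F} (hG : ∀ i, G i ^ p = pderiv i f)
    (hG1 : ∀ i, (G i).IsHomogeneous 1) (hfG : ∑ i, X i * G i ^ p = f) :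
    ∃ a : Fin 3 → F, a ≠ 0 ∧ Transverse f a d := by
  have hp : p ≠ 0 := (Fact.out : p.Prime).ne_zero
  obtain ⟨R, hR⟩ : ∃ R : Fin 3 → F, eval R f ≠ 0 := by
    by_contra! h
    exact hf0 (hf.eq_zero_of_forall_eval_eq_zero_of_le_card h (by simpa using hdq))
  set φ := algebraMap F (AlgebraicClosure F)
  refine exists_transverse_of_forall_aeval_ne hf hd hs hG (b := fun i => eval R (G i))
    (fun h0 => hR ?_) fun P hP hfP c hc hPc => ?_
  · rw [← hfG, map_sum]
    refine Finset.sum_eq_zero fun i _ => ?_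
    rw [map_mul, map_pow, show eval R (G i) = 0 from congrFun h0 i, zero_pow hp, mul_zero]
  · set v : Fin 3 → AlgebraicClosure F := fun i => P i + (-c) * φ (R i) with hv
    have hGv : ∀ i, aeval v (G i) = 0 := fun i => by
      rw [hv, aeval_add_mul_of_isHomogeneous_one (hG1 i), aeval_algebraMap_comp, hPc i]
      ring
    have hv0 : v = 0 := by
      by_contra hv0
      obtain ⟨i, hi⟩ := hs.exists_aeval_pderiv_ne_zero hf hv0 (by
        rw [← hfG, map_sum]
        refine Finset.sum_eq_zero fun i _ => ?_
        rw [map_mul, map_pow, hGv, zero_pow hp, mul_zero])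
      exact hi (by rw [← hG, map_pow, hGv, zero_pow hp])
    have hP' : P = fun i => φ (R i) * c := funext fun i => by
      have := congrFun hv0 i
      simp only [hv, Pi.zero_apply] at this
      linear_combination this
    rw [hP', aeval_mul_of_isHomogeneous hf, aeval_algebraMap_comp] at hfP
    rcases mul_eq_zero.1 hfP with h0 | h0
    · exact hR ((map_eq_zero φ).1 h0)
    · exact pow_ne_zero d hc h0

/-- A form `Φ` vanishing at the values of `G` on the tangency locus yields a transverse line. -/
lemma exists_transverse_of_form [Fintype F] {f : MvPolynomial (Fin 3) F} {d s e : ℕ}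
    (hf : f.IsHomogeneous d) (hd : d ≠ 0) (hs : SmoothCurve f)
    {G : Fin 3 → MvPolynomial (Fin 3) F} (hG : ∀ i, G i ^ p = pderiv i f)
    (hfG : ∑ i, X i * G i ^ p = f) (hcard : Fintype.card F = s * p)
    {Φ : MvPolynomial (Fin 3) F} (hΦ : Φ.IsHomogeneous e) (hΦ0 : Φ ≠ 0) (he0 : e ≠ 0)
    (he : e ≤ Fintype.card F)
    (h : ∀ P : Fin 3 → AlgebraicClosure F, aeval P f = 0 → aeval P (∑ i, X i ^ s * G i) = 0 →
      aeval P (aeval G Φ) = 0) :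
    ∃ a : Fin 3 → F, a ≠ 0 ∧ Transverse f a d := by
  have hp : p ≠ 0 := (Fact.out : p.Prime).ne_zero
  have : CharP (AlgebraicClosure F) p := charP_of_injective_algebraMap
    (algebraMap F (AlgebraicClosure F)).injective p
  obtain ⟨b, hb⟩ : ∃ b : Fin 3 → F, eval b Φ ≠ 0 := by
    by_contra! h
    exact hΦ0 (hΦ.eq_zero_of_forall_eval_eq_zero_of_le_card h (by simpa using he))
  set φ := algebraMap F (AlgebraicClosure F)
  refine exists_transverse_of_forall_aeval_ne hf hd hs hG (b := b) ?_
    fun P hP hfP c hc hPc => ?_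
  · rintro rfl
    have := aeval_mul_of_isHomogeneous hΦ (0 : Fin 3 → F) 0
    rw [zero_pow he0, mul_zero] at this
    exact hb (by simpa [coe_aeval_eq_eval] using this)
  · have hline : ∑ i, P i * φ (b i) ^ p = 0 := by
      have h1 := hfP
      rw [← hfG, map_sum] at h1
      simp only [map_mul, map_pow, aeval_X, hPc, mul_pow] at h1
      simp only [mul_left_comm (P _), ← Finset.mul_sum] at h1
      exact (mul_eq_zero.1 h1).resolve_left (pow_ne_zero p hc)
    have hfrob : ∑ i, P i ^ (s * p) * φ (b i) ^ p = 0 := by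
      obtain ⟨n, hpn, hn⟩ := FiniteField.card F p
      have h1 := congrArg (· ^ Fintype.card F) hline
      simp only [hn] at h1
      rw [sum_pow_char_pow, zero_pow (pow_ne_zero _ hp)] at h1
      rw [← h1]
      refine Finset.sum_congr rfl fun i _ => ?_
      rw [← hcard, mul_pow, ← hn, ← pow_mul, mul_comm p, pow_mul (φ (b i)),
        ← map_pow φ _ (Fintype.card F), FiniteField.pow_card]
    have hh : aeval P (∑ i, X i ^ s * G i) = 0 := by
      rw [← pow_eq_zero_iff hp, map_sum, sum_pow_char]
      simp only [map_mul, map_pow, aeval_X, hPc, mul_pow, ← pow_mul]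
      simp only [mul_left_comm (P _ ^ _), ← Finset.mul_sum]
      rw [hfrob, mul_zero]
    have hval := h P hfP hh
    rw [comp_aeval_apply, show (fun i => aeval P (G i)) = fun i => φ (b i) * c from
      funext fun i => by rw [hPc, mul_comm], aeval_mul_of_isHomogeneous hΦ] at hval
    rcases mul_eq_zero.1 hval with h0 | h0
    · rw [aeval_algebraMap_comp] at h0
      exact hb ((map_eq_zero φ).1 h0)
    · exact pow_ne_zero e hc h0

lemma two_mul_choose_two (n : ℕ) : 2 * (n + 2).choose 2 = (n + 2) * (n + 1) := by
  rw [Nat.choose_two_right, Nat.add_sub_assoc (by norm_num), Nat.mul_div_cancel']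
  exact (Nat.even_mul_succ_self (n + 1)).two_dvd.trans (by simp [mul_comm])

lemma sum_X_pow_mul_ne_zero {G : Fin 3 → MvPolynomial (Fin 3) F} {k s : ℕ}
    (hG : ∀ i, (G i).IsHomogeneous k) (hks : k < s) {i : Fin 3} (hi : G i ≠ 0) :
    ∑ i, X i ^ s * G i ≠ 0 := by
  classical
  intro h0
  obtain ⟨m, hm⟩ := ne_zero_iff.1 hi
  have hdeg : m.degree = k := by
    by_contra hne
    exact hm ((hG i).coeff_eq_zero hne)
  apply hm
  have h1 := congrArg (coeff (Finsupp.single i s + m)) h0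
  rw [coeff_sum, coeff_zero, Finset.sum_eq_single i] at h1
  · rwa [X_pow_eq_monomial, coeff_monomial_mul, one_mul] at h1
  · intro j _ hj
    rw [X_pow_eq_monomial, coeff_monomial_mul', if_neg]
    intro hle
    have h2 := hle j
    have h3 := Finsupp.le_degree j m
    simp [hj.symm] at h2
    omega
  · simp

end TangentLines

section QuadraticGradient

variable {p : ℕ} [Fact p.Prime] [CharP F p]

/-- A curve of degree `2p + 1` whose gradient consists of `p`-th powers of quadratic forms has a
transverse line over a field of order at least `p ^ 3`. -/
lemma exists_transverse_of_quadratic_of_three_le [Fintype F] {f : MvPolynomial (Fin 3) F} {r : ℕ}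
    (hp : 2 < p) (hr : 3 ≤ r) (hcard : Fintype.card F = p ^ r) (hf0 : f ≠ 0)
    (hf : f.IsHomogeneous (2 * p + 1)) (hs : SmoothCurve f)
    {G : Fin 3 → MvPolynomial (Fin 3) F} (hG : ∀ i, G i ^ p = pderiv i f)
    (hG2 : ∀ i, (G i).IsHomogeneous 2) (hfG : ∑ i, X i * G i ^ p = f) :
    ∃ a : Fin 3 → F, a ≠ 0 ∧ Transverse f a (2 * p + 1) := by
  obtain ⟨e, he⟩ : ∃ e, e = 8 * p := ⟨_, rfl⟩
  obtain ⟨m, hm⟩ : ∃ m, m + 1 = 14 * p := ⟨14 * p - 1, by omega⟩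
  obtain ⟨Φ, hΦ, hΦ0, hmem⟩ := exists_form_aeval_mem (e := e) hG2
    (formMultiples_le (m := m) hf (by omega)) (by
      rw [finrank_formMultiples hf0]
      have h1 := two_mul_choose_two (2 * e)
      have h2 := two_mul_choose_two e
      have h3 := two_mul_choose_two m
      obtain rfl : m = 14 * p - 1 := by omega
      rw [show 14 * p - 1 + 2 = 14 * p + 1 by omega] at *
      rw [hm] at h3
      subst he
      nlinarith)
  obtain ⟨t, -, ht⟩ := mem_formMultiples.1 hmem
  refine exists_transverse_of_form (s := p ^ (r - 1)) hf (by omega) hs hG hfG ?_ hΦ hΦ0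
    (by omega) ?_ fun P hP _ => by rw [← ht, map_mul, hP, zero_mul]
  · rw [hcard, ← pow_succ, Nat.sub_add_cancel (by omega)]
  · rw [hcard, he]
    refine le_trans ?_ (Nat.pow_le_pow_right (by omega) hr)
    nlinarith [Nat.mul_le_mul hp hp]

/-- A curve of degree `2p + 1` whose gradient consists of `p`-th powers of quadratic forms has a
transverse line over a field of order `p ^ 2`. -/
lemma exists_transverse_of_quadratic_of_card_eq_sq [Fintype F] {f : MvPolynomial (Fin 3) F}
    (hp : 2 < p) (hcard : Fintype.card F = p ^ 2) (hf0 : f ≠ 0)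
    (hf : f.IsHomogeneous (2 * p + 1)) (hs : SmoothCurve f)
    {G : Fin 3 → MvPolynomial (Fin 3) F} (hG : ∀ i, G i ^ p = pderiv i f)
    (hG2 : ∀ i, (G i).IsHomogeneous 2) (hfG : ∑ i, X i * G i ^ p = f) :
    ∃ a : Fin 3 → F, a ≠ 0 ∧ Transverse f a (2 * p + 1) := by
  obtain ⟨n, rfl⟩ : ∃ n, p = n + 1 := ⟨p - 1, by omega⟩
  set h : MvPolynomial (Fin 3) F := ∑ i, X i ^ (n + 1) * G i with hh
  have hhd : h.IsHomogeneous (n + 1 + 2) :=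
    IsHomogeneous.sum _ _ _ fun i _ => (isHomogeneous_X_pow i _).mul (hG2 i)
  have hh0 : h ≠ 0 := by
    obtain ⟨i, hi⟩ : ∃ i, G i ≠ 0 := by
      by_contra! h0
      exact hf0 (by rw [← hfG]; simp [h0])
    exact sum_X_pow_mul_ne_zero hG2 hp hi
  have hfh : ¬ f ∣ h := fun hdvd => hh0 (eq_zero_of_dvd_of_lt hf hhd (by omega) hdvd)
  obtain ⟨Φ, hΦ, hΦ0, hmem⟩ := exists_form_aeval_mem (e := 2 * (n + 1) + 1) hG2
    (sup_le (formMultiples_le (m := 2 * (n + 1) + 1) hf (by ring))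
      (formMultiples_le (m := 2 * (n + 1) + 1 + n) hhd (by ring))) (by
      have h0 := le_finrank_formMultiples_sup (j := 2 * (n + 1) + 1) (m := n)
        (hs.irreducible hf0 hf (by omega)) hf hfh
      have h1 := two_mul_choose_two (2 * (2 * (n + 1) + 1))
      have h2 := two_mul_choose_two (2 * (n + 1) + 1)
      have h3 := two_mul_choose_two (2 * (n + 1) + 1 + n)
      have h4 := two_mul_choose_two n
      nlinarith)
  obtain ⟨_, hu, _, hv, huv⟩ := Submodule.mem_sup.1 hmem
  obtain ⟨t, -, rfl⟩ := mem_formMultiples.1 hu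
  obtain ⟨t', -, rfl⟩ := mem_formMultiples.1 hv
  refine exists_transverse_of_form (s := n + 1) hf (by omega) hs hG hfG (by rw [hcard, sq])
    hΦ hΦ0 (by omega) (by nlinarith) fun P hP hhP => ?_
  rw [← huv, map_add, map_mul, map_mul, hP, hhP, zero_mul, zero_mul, add_zero]

end QuadraticGradient

/-- **Theorem 2 (Bertini for non-reflexive curves of degree `p+1` and `2p+1`).**
If `C` is a smooth non-reflexive plane curve (i.e. `C` has infinitely many flex points)
of degree `p + 1` or `2p + 1` over `F_q`, `q = p^r`, `p > 2` prime, `r ≥ 2`, then some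
`F_q`-line meets `C` transversely. -/
theorem bertini_nonreflexive
    (p r q d : ℕ) [Fact p.Prime] (hp : 2 < p) (hr : 2 ≤ r) (hq : q = p ^ r)
    (F : Type*) [Field F] [Fintype F] [CharP F p] (hcard : Fintype.card F = q)
    (f : MvPolynomial (Fin 3) F) (hf0 : f ≠ 0) (hfd : f.IsHomogeneous d)
    (hd : d = p + 1 ∨ d = 2 * p + 1)
    (hsmooth : SmoothCurve f)
    (hnonreflexive : {P : ProjPlane (AlgebraicClosure F) | IsFlex f P}.Infinite) :
    ∃ a : Fin 3 → F, a ≠ 0 ∧ Transverse f a d := by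
  subst hq
  have h2 : (2 : F) ≠ 0 := fun h0 =>
    absurd (Nat.le_of_dvd two_pos ((CharP.cast_eq_zero_iff F p 2).1 (by exact_mod_cast h0)))
      (by omega)
  have hdF : (d : F) = 1 := by
    rcases hd with rfl | rfl <;> simp
  obtain ⟨k, hk⟩ : ∃ k, d - 1 = p * k := by
    rcases hd with rfl | rfl
    exacts [⟨1, by simp⟩, ⟨2, by simp [mul_comm]⟩]
  have hG : ∀ i, ∃ G : MvPolynomial (Fin 3) F, G.IsHomogeneous k ∧ G ^ p = pderiv i f := fun i =>
    exists_pow_char_eq_of_pderiv_eq_zero (hk ▸ hfd.pderiv) fun j =>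
      pderiv_pderiv_eq_zero_of_flexes h2 hf0 hfd (by omega) hdF hsmooth hnonreflexive j i
  choose G hGk hG using hG
  have hfG : ∑ i, X i * G i ^ p = f := by
    simp only [hG]
    rw [hfd.sum_X_mul_pderiv, nsmul_eq_mul, ← map_natCast C, hdF, C_1, one_mul]
  rcases hd with rfl | rfl
  · obtain rfl : k = 1 := Nat.eq_of_mul_eq_mul_left (by omega : 0 < p) (by omega)
    refine exists_transverse_of_linear hf0 hfd (by omega) ?_ hsmooth hG hGk hfG
    rw [hcard]
    exact le_trans (by nlinarith) (Nat.pow_le_pow_right (by omega) hr)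
  · obtain rfl : k = 2 := Nat.eq_of_mul_eq_mul_left (by omega : 0 < p) (by omega)
    rcases hr.eq_or_lt with rfl | hr
    · exact exists_transverse_of_quadratic_of_card_eq_sq hp hcard hf0 hfd hsmooth hG hGk hfG
    · exact exists_transverse_of_quadratic_of_three_le hp hr hcard hf0 hfd hsmooth hG hGk hfG

end
end
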